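/- arXiv:1201.4439 — 2 statements merged into one kernel-verified Lean document; each statement's English description precedes it below -/
import Mathlib

section
/- Suppose a relation R on ℤ × ℕ is definable in M_Z, some nonzero integer is regular with respect to Γ_R, and d is the greatest common divisor of the integers regular with respect to Γ_R. Then: (i) if every permutation in Γ_R is of the first type (with respect to d), then R ≈ A_d; (ii) if Γ_R contains a permutation of the second type but none of the third type, then R ≈ B_d; (iii) if Γ_R contains a permutation of the third type, then R ≈ C_d. Here A_d is the binary relation a − b = d on ℤ × ℕ, B_d is the 4-ary relation (a₁ − a₂ = d ∧ a₃ − a₄ = d) ∨ (a₁ − a₂ = −d ∧ a₃ − a₄ = −d), and C_d is the binary relation |a − b| = d, and Q ≈ R means that each of Q, R is definable without parameters by a first-order formula in the language with a single relation symbol interpreted as the other. -/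
open FirstOrder Language

/-- Language with relation symbols indexed by `ι`, where symbol `i` has arity `ar i`. -/
def multiRelLang {ι : Type} (ar : ι → ℕ) : FirstOrder.Language where
  Functions _ := Empty
  Relations m := { i : ι // ar i = m }

/-- The structure on `M` interpreting symbol `i` as the relation `Rels i`. -/
def multiRelStructure {M : Type*} {ι : Type} {ar : ι → ℕ}
    (Rels : ∀ i, (Fin (ar i) → M) → Prop) : (multiRelLang ar).Structure M where
  funMap f := f.elim
  RelMap r x := Rels r.1 fun j => x (Fin.cast r.2 j)

/-- Language with one relation symbol, of arity `n`. -/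
def relLang (n : ℕ) : FirstOrder.Language := multiRelLang (fun _ : Unit => n)

/-- `R` is definable, without parameters, by a first-order formula in the language with a
single relation symbol interpreted as `Q`. -/
def DefinableBy {M : Type*} {n k : ℕ} (Q : (Fin n → M) → Prop)
    (R : (Fin k → M) → Prop) : Prop :=
  letI : (relLang n).Structure M := multiRelStructure (fun _ : Unit => Q)
  ∃ φ : (relLang n).Formula (Fin k), ∀ v : Fin k → M, R v ↔ φ.Realize v

/-- The difference `a − b` of elements of `ℤ × ℕ` (the support of `M_Z`), an element of
`ℤ ∪ {∞}`: it is `a¹ − b¹` if the two elements are in the same galaxy, `∞` otherwise. -/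
def diff (a b : ℤ × ℕ) : WithTop ℤ := if a.2 = b.2 then ((a.1 - b.1 : ℤ) : WithTop ℤ) else ⊤

/-- A shift: a bijection of `ℤ × ℕ` preserving all differences. -/
def IsShift (f : Equiv.Perm (ℤ × ℕ)) : Prop := ∀ a b : ℤ × ℕ, diff (f a) (f b) = diff a b

/-- The set `K_z = {γ(a) − γ(b) : γ ∈ G, a − b = z}` for a set `G` of permutations. -/
def KSet (G : Set (Equiv.Perm (ℤ × ℕ))) (z : WithTop ℤ) : Set (WithTop ℤ) :=
  {w | ∃ γ ∈ G, ∃ a b : ℤ × ℕ, diff a b = z ∧ diff (γ a) (γ b) = w}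

/-- An integer `z` is regular with respect to `G` if `K_z` is finite and `∞ ∉ K_z`. -/
def Regular (G : Set (Equiv.Perm (ℤ × ℕ))) (z : ℤ) : Prop :=
  (KSet G ((z : ℤ) : WithTop ℤ)).Finite ∧ ⊤ ∉ KSet G ((z : ℤ) : WithTop ℤ)

/-- Absolute value on `ℤ ∪ {∞}`, with `|∞| = ∞`. -/
def wabs : WithTop ℤ → WithTop ℤ := WithTop.map (fun z : ℤ => |z|)

/-- The successor relation of `M_Z` on `ℤ × ℕ`: `v 1` is the successor of `v 0`. -/
def succRel : (Fin 2 → ℤ × ℕ) → Prop := fun v => v 1 = ((v 0).1 + 1, (v 0).2)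

/-- `a + z` : shifting an element of `ℤ × ℕ` by an integer within its galaxy. -/
def shiftBy (a : ℤ × ℕ) (z : ℤ) : ℤ × ℕ := (a.1 + z, a.2)

/-- A permutation `g` preserves the `n`-ary relation `R` if `R(ā) ↔ R(g ∘ ā)` always. -/
def Preserves {n : ℕ} (g : Equiv.Perm (ℤ × ℕ)) (R : (Fin n → ℤ × ℕ) → Prop) : Prop :=
  ∀ v : Fin n → ℤ × ℕ, R (⇑g ∘ v) ↔ R v

/-- `Γ_R` : the set (group) of permutations of `ℤ × ℕ` preserving `R`. -/
def GammaR {n : ℕ} (R : (Fin n → ℤ × ℕ) → Prop) : Set (Equiv.Perm (ℤ × ℕ)) :=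
  {g | Preserves g R}

/-- `f` is of the first type (w.r.t. `d`): `f(a + n·d) − f(a) = n·d` for all `a, n`. -/
def FirstType (d : ℤ) (f : Equiv.Perm (ℤ × ℕ)) : Prop :=
  ∀ (a : ℤ × ℕ) (n : ℕ), diff (f (shiftBy a (n * d))) (f a) = ((n * d : ℤ) : WithTop ℤ)

/-- `f` is of the second type (w.r.t. `d`): `f(a + n·d) − f(a) = −n·d` for all `a, n`. -/
def SecondType (d : ℤ) (f : Equiv.Perm (ℤ × ℕ)) : Prop :=
  ∀ (a : ℤ × ℕ) (n : ℕ), diff (f (shiftBy a (n * d))) (f a) = ((-(n * d) : ℤ) : WithTop ℤ)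

/-- `f` is of the third type (w.r.t. `d`): `f(a + n·d) − f(a) ∈ {n·d, −n·d}` always, and
both signs actually occur (for some nonzero multiple). -/
def ThirdType (d : ℤ) (f : Equiv.Perm (ℤ × ℕ)) : Prop :=
  (∀ (a : ℤ × ℕ) (n : ℕ),
      diff (f (shiftBy a (n * d))) (f a) = ((n * d : ℤ) : WithTop ℤ) ∨
      diff (f (shiftBy a (n * d))) (f a) = ((-(n * d) : ℤ) : WithTop ℤ)) ∧
  (∃ (a : ℤ × ℕ) (n : ℕ), 0 < n ∧
      diff (f (shiftBy a (n * d))) (f a) = ((n * d : ℤ) : WithTop ℤ)) ∧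
  (∃ (a : ℤ × ℕ) (n : ℕ), 0 < n ∧
      diff (f (shiftBy a (n * d))) (f a) = ((-(n * d) : ℤ) : WithTop ℤ))

/-- The binary relation `A_d` : `a − b = d` on `ℤ × ℕ`. -/
def Arel (d : ℤ) : (Fin 2 → ℤ × ℕ) → Prop := fun v => diff (v 0) (v 1) = (d : WithTop ℤ)

/-- The 4-ary relation `B_d` : `(a₁ − a₂ = d ∧ a₃ − a₄ = d) ∨ (a₁ − a₂ = −d ∧ a₃ − a₄ = −d)`. -/
def Brel (d : ℤ) : (Fin 4 → ℤ × ℕ) → Prop := fun v =>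
  (diff (v 0) (v 1) = (d : WithTop ℤ) ∧ diff (v 2) (v 3) = (d : WithTop ℤ)) ∨
  (diff (v 0) (v 1) = ((-d : ℤ) : WithTop ℤ) ∧ diff (v 2) (v 3) = ((-d : ℤ) : WithTop ℤ))

/-- The binary relation `C_d` : `|a − b| = d` on `ℤ × ℕ`. -/
def Crel (d : ℤ) : (Fin 2 → ℤ × ℕ) → Prop := fun v => wabs (diff (v 0) (v 1)) = (d : WithTop ℤ)

/-- `Q ≈ R` : the relations `Q` and `R` define each other. -/
def DefEquiv {M : Type*} {n k : ℕ} (Q : (Fin n → M) → Prop)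
    (R : (Fin k → M) → Prop) : Prop :=
  DefinableBy Q R ∧ DefinableBy R Q

/-! ### Differences and translations -/

theorem diff_eq_coe {a b : ℤ × ℕ} {m : ℤ} : diff a b = (m : WithTop ℤ) ↔ a = shiftBy b m := by
  unfold diff shiftBy
  split_ifs with h
  · rw [WithTop.coe_inj, Prod.ext_iff]
    simp only [h, and_true]
    omega
  · simp only [WithTop.top_ne_coe, false_iff]
    rintro rfl
    exact h rfl

theorem diff_eq_top {a b : ℤ × ℕ} : diff a b = ⊤ ↔ a.2 ≠ b.2 := by
  unfold diff
  split_ifs with h <;> simp [h]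

@[simp] theorem shiftBy_zero (a : ℤ × ℕ) : shiftBy a 0 = a := by simp [shiftBy]

@[simp] theorem shiftBy_shiftBy (a : ℤ × ℕ) (m k : ℤ) :
    shiftBy (shiftBy a m) k = shiftBy a (m + k) := by simp [shiftBy, add_assoc]

@[simp] theorem shiftBy_snd (a : ℤ × ℕ) (m : ℤ) : (shiftBy a m).2 = a.2 := rfl

theorem shiftBy_inj {a : ℤ × ℕ} {m k : ℤ} : shiftBy a m = shiftBy a k ↔ m = k := by
  simp [shiftBy]

theorem eq_shiftBy_self {a : ℤ × ℕ} {m : ℤ} : a = shiftBy a m ↔ m = 0 := by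
  simp [shiftBy, Prod.ext_iff]

theorem shiftBy_left_inj {a b : ℤ × ℕ} {m : ℤ} : shiftBy a m = shiftBy b m ↔ a = b := by
  simp [shiftBy, Prod.ext_iff]

theorem eq_shiftBy_comm {a b : ℤ × ℕ} {m : ℤ} : a = shiftBy b m ↔ b = shiftBy a (-m) := by
  constructor <;> rintro rfl <;> simp

theorem eq_shiftBy_of_snd_eq {a b : ℤ × ℕ} (h : a.2 = b.2) : a = shiftBy b (a.1 - b.1) := by
  simp [shiftBy, Prod.ext_iff, h]

/-! ### Local relations -/

/-- The tuples `x` and `y` have the same pairwise differences, as far as differences of absolute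
value at most `N` are concerned. -/
def Near {ι : Type} (N : ℕ) (x y : ι → ℤ × ℕ) : Prop :=
  ∀ i j, ∀ m : ℤ, |m| ≤ N → (x i = shiftBy (x j) m ↔ y i = shiftBy (y j) m)

/-- A set of tuples is local if membership depends only on the differences of bounded absolute
value between the entries. -/
def IsLocal {ι : Type} (S : Set (ι → ℤ × ℕ)) : Prop :=
  ∃ N, ∀ x y, Near N x y → (x ∈ S ↔ y ∈ S)

theorem Near.mono {ι : Type} {N N' : ℕ} {x y : ι → ℤ × ℕ} (h : Near N' x y) (hN : N ≤ N') :
    Near N x y := fun i j m hm => h i j m (hm.trans (by exact_mod_cast hN))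

theorem Near.symm {ι : Type} {N : ℕ} {x y : ι → ℤ × ℕ} (h : Near N x y) : Near N y x :=
  fun i j m hm => (h i j m hm).symm

theorem Near.comp {ι κ : Type} {N : ℕ} {x y : ι → ℤ × ℕ} (h : Near N x y) (f : κ → ι) :
    Near N (x ∘ f) (y ∘ f) := fun i j m hm => h (f i) (f j) m hm

theorem exists_fresh_galaxy {ι : Type} [Finite ι] (y : ι → ℤ × ℕ) : ∃ g : ℕ, ∀ i, (y i).2 ≠ g := by
  obtain ⟨g, hg⟩ := (Set.finite_range fun i => (y i).2).exists_notMem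
  exact ⟨g, fun i hi => hg ⟨i, hi⟩⟩

theorem Near.exists_extend {ι : Type} [Finite ι] {N : ℕ} {x y : ι → ℤ × ℕ}
    (h : Near (2 * N) x y) (u : ℤ × ℕ) :
    ∃ w, ∀ i, ∀ m : ℤ, |m| ≤ N → (u = shiftBy (x i) m ↔ w = shiftBy (y i) m) := by
  by_cases hu : ∃ i, ∃ k : ℤ, |k| ≤ N ∧ u = shiftBy (x i) k
  · obtain ⟨i, k, hk, rfl⟩ := hu
    refine ⟨shiftBy (y i) k, fun j m hm => ?_⟩
    have key := h i j (m - k) ((abs_sub m k).trans (by push_cast; linarith))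
    have aux : ∀ z : ι → ℤ × ℕ, shiftBy (z i) k = shiftBy (z j) m ↔ z i = shiftBy (z j) (m - k) := by
      intro z
      rw [← shiftBy_left_inj (m := -k)]
      simp [sub_eq_add_neg]
    rw [aux, aux, key]
  · push Not at hu
    obtain ⟨g, hg⟩ := exists_fresh_galaxy y
    refine ⟨(0, g), fun i m hm => iff_of_false (hu i m hm) fun e => hg i ?_⟩
    simpa using (congrArg Prod.snd e).symm

theorem Near.of_extend {ι : Type} {n : ℕ} {N : ℕ} {v v' : ι → ℤ × ℕ} {xs xs' : Fin n → ℤ × ℕ}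
    {u w : ℤ × ℕ} (h : Near N (Sum.elim v xs) (Sum.elim v' xs'))
    (hu : ∀ i, ∀ m : ℤ, |m| ≤ N →
      (u = shiftBy (Sum.elim v xs i) m ↔ w = shiftBy (Sum.elim v' xs' i) m)) :
    Near N (Sum.elim v (Fin.snoc xs u : Fin (n + 1) → ℤ × ℕ))
      (Sum.elim v' (Fin.snoc xs' w : Fin (n + 1) → ℤ × ℕ)) := by
  have hcase : ∀ i : ι ⊕ Fin (n + 1), i = Sum.inr (Fin.last n) ∨ ∃ j : ι ⊕ Fin n,
      ∀ (v : ι → ℤ × ℕ) (xs : Fin n → ℤ × ℕ) (u : ℤ × ℕ),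
        Sum.elim v (Fin.snoc xs u : Fin (n + 1) → ℤ × ℕ) i = Sum.elim v xs j := by
    rintro (i | i)
    · exact Or.inr ⟨Sum.inl i, fun _ _ _ => rfl⟩
    · refine Fin.lastCases (Or.inl rfl) (fun i => Or.inr ⟨Sum.inr i, fun _ _ _ => ?_⟩) i
      simp
  intro i j m hm
  rcases hcase i with rfl | ⟨i, hi⟩ <;> rcases hcase j with rfl | ⟨j, hj⟩
  · simp [eq_shiftBy_self]
  · simp only [hj, Sum.elim_inr, Fin.snoc_last]
    exact hu j m hm
  · simp only [hi, Sum.elim_inr, Fin.snoc_last]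
    rw [eq_shiftBy_comm, eq_shiftBy_comm (b := w)]
    exact hu i (-m) (by rwa [abs_neg])
  · simp only [hi, hj]
    exact h i j m hm

theorem IsLocal.compl {ι : Type} {S : Set (ι → ℤ × ℕ)} (h : IsLocal S) : IsLocal Sᶜ := by
  obtain ⟨N, hN⟩ := h
  exact ⟨N, fun x y hxy => not_congr (hN x y hxy)⟩

theorem IsLocal.inter {ι : Type} {S T : Set (ι → ℤ × ℕ)} (hS : IsLocal S) (hT : IsLocal T) :
    IsLocal (S ∩ T) := by
  obtain ⟨N, hN⟩ := hS
  obtain ⟨N', hN'⟩ := hT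
  exact ⟨max N N', fun x y hxy => and_congr (hN x y (hxy.mono (le_max_left _ _)))
    (hN' x y (hxy.mono (le_max_right _ _)))⟩

theorem IsLocal.union {ι : Type} {S T : Set (ι → ℤ × ℕ)} (hS : IsLocal S) (hT : IsLocal T) :
    IsLocal (S ∪ T) := by
  have := (hS.compl.inter hT.compl).compl
  rwa [← Set.compl_union, _root_.compl_compl] at this

theorem IsLocal.preimage_comp {ι κ : Type} {S : Set (ι → ℤ × ℕ)} (hS : IsLocal S) (f : ι → κ) :
    IsLocal ((fun x : κ → ℤ × ℕ => x ∘ f) ⁻¹' S) := by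
  obtain ⟨N, hN⟩ := hS
  exact ⟨N, fun x y hxy => hN _ _ (hxy.comp f)⟩

theorem isLocal_eq_shiftBy {ι : Type} (i j : ι) (m : ℤ) :
    IsLocal {x : ι → ℤ × ℕ | x i = shiftBy (x j) m} :=
  ⟨m.natAbs, fun _ _ h => h i j m (by simp)⟩

/-- The structure on `ℤ × ℕ` in the language `relLang n` given by the relation `R`. -/
abbrev relStructure {n : ℕ} (R : (Fin n → ℤ × ℕ) → Prop) : (relLang n).Structure (ℤ × ℕ) :=
  multiRelStructure (fun _ : Unit => R)

/-- Every formula in the language of a local relation defines a local relation. -/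
theorem isLocal_realize {n : ℕ} {R : (Fin n → ℤ × ℕ) → Prop} (hR : IsLocal {v | R v})
    {α : Type} [Finite α] {k : ℕ} (φ : (relLang n).BoundedFormula α k) :
    letI := relStructure R
    IsLocal {z : α ⊕ Fin k → ℤ × ℕ | φ.Realize (z ∘ Sum.inl) (z ∘ Sum.inr)} := by
  let _ := relStructure R
  have hterm : ∀ {k : ℕ} (t : (relLang n).Term (α ⊕ Fin k)), ∃ i, ∀ z : α ⊕ Fin k → ℤ × ℕ,
      t.realize z = z i := by
    intro k t
    cases t with
    | var i => exact ⟨i, fun z => by rw [FirstOrder.Language.Term.realize_var]⟩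
    | func f _ => exact f.elim
  induction φ with
  | falsum => exact ⟨0, fun _ _ _ => Iff.rfl⟩
  | equal t₁ t₂ =>
    obtain ⟨i, hi⟩ := hterm t₁
    obtain ⟨j, hj⟩ := hterm t₂
    have := isLocal_eq_shiftBy i j 0
    simpa [FirstOrder.Language.BoundedFormula.Realize, hi, hj] using this
  | @rel k l r ts =>
    choose f hf using fun i => hterm (ts i)
    obtain ⟨u, rfl⟩ := r
    have := hR.preimage_comp f
    simp only [FirstOrder.Language.BoundedFormula.Realize, Sum.elim_comp_inl_inr, hf]
    exact this
  | imp φ ψ hφ hψ =>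
    have := hφ.compl.union hψ
    refine (congrArg IsLocal (Set.ext fun z => ?_)).mpr this
    exact imp_iff_not_or
  | @all k φ hφ =>
    obtain ⟨N, hN⟩ := hφ
    have main : ∀ x y : α ⊕ Fin k → ℤ × ℕ, Near (2 * N) x y →
        φ.all.Realize (x ∘ Sum.inl) (x ∘ Sum.inr) → φ.all.Realize (y ∘ Sum.inl) (y ∘ Sum.inr) := by
      intro x y hxy hx u
      obtain ⟨w, hw⟩ := hxy.symm.exists_extend u
      have hnear : Near N (Sum.elim (x ∘ Sum.inl) (Fin.snoc (x ∘ Sum.inr) w : Fin (k + 1) → ℤ × ℕ))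
          (Sum.elim (y ∘ Sum.inl) (Fin.snoc (y ∘ Sum.inr) u : Fin (k + 1) → ℤ × ℕ)) := by
        apply Near.of_extend
        · simpa only [Sum.elim_comp_inl_inr] using hxy.mono (by omega)
        · simpa only [Sum.elim_comp_inl_inr] using fun i m hm => (hw i m hm).symm
      exact (hN _ _ hnear).mp (hx w)
    exact ⟨2 * N, fun x y hxy => ⟨main x y hxy, main y x hxy.symm⟩⟩

theorem isLocal_succRel : IsLocal {v | succRel v} := isLocal_eq_shiftBy 1 0 1

/-! ### Sets of tuples definable from a relation -/

/-- The set `S` of tuples is definable without parameters from the relation `R`. -/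
def DefFrom {n : ℕ} (R : (Fin n → ℤ × ℕ) → Prop) {α : Type} (S : Set (α → ℤ × ℕ)) : Prop :=
  letI := relStructure R
  (∅ : Set (ℤ × ℕ)).Definable (relLang n) S

section DefFrom

variable {n : ℕ} {R : (Fin n → ℤ × ℕ) → Prop} {α : Type} {S T : Set (α → ℤ × ℕ)}

theorem definableBy_iff {k : ℕ} {Q : (Fin k → ℤ × ℕ) → Prop} :
    DefinableBy R Q ↔ DefFrom R {v | Q v} := by
  let _ := relStructure R
  refine Iff.trans ?_ Set.empty_definable_iff.symm
  simp only [Set.ext_iff]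
  exact Iff.rfl

theorem DefFrom.inter (hS : DefFrom R S) (hT : DefFrom R T) : DefFrom R (S ∩ T) :=
  let _ := relStructure R
  Set.Definable.inter hS hT

theorem DefFrom.compl (hS : DefFrom R S) : DefFrom R Sᶜ :=
  let _ := relStructure R
  Set.Definable.compl hS

theorem DefFrom.preimage_comp {β : Type} (f : α → β) (hS : DefFrom R S) :
    DefFrom R ((fun x : β → ℤ × ℕ => x ∘ f) ⁻¹' S) :=
  let _ := relStructure R
  Set.Definable.preimage_comp f hS

theorem DefFrom.image_comp {β : Type} [Finite α] [Finite β] (f : β → α) (hS : DefFrom R S) :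
    DefFrom R ((fun x : α → ℤ × ℕ => x ∘ f) '' S) :=
  let _ := relStructure R
  Set.Definable.image_comp hS f

theorem DefFrom.iUnion {ι : Type} [Finite ι] {S : ι → Set (α → ℤ × ℕ)}
    (h : ∀ i, DefFrom R (S i)) : DefFrom R (⋃ i, S i) :=
  let _ := relStructure R
  Set.definable_iUnion_of_finite h

theorem DefFrom.iInter {ι : Type} [Finite ι] {S : ι → Set (α → ℤ × ℕ)}
    (h : ∀ i, DefFrom R (S i)) : DefFrom R (⋂ i, S i) :=
  let _ := relStructure R
  Set.definable_iInter_of_finite h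

theorem defFrom_univ : DefFrom R (Set.univ : Set (α → ℤ × ℕ)) :=
  let _ := relStructure R
  Set.definable_univ

theorem defFrom_eq (i j : α) : DefFrom R {x : α → ℤ × ℕ | x i = x j} := by
  let _ := relStructure R
  exact Set.empty_definable_iff.mpr ⟨(FirstOrder.Language.var i).equal (FirstOrder.Language.var j), by
    ext; simp [FirstOrder.Language.Formula.realize_equal]⟩

theorem defFrom_self : DefFrom R {v | R v} := by
  let _ := relStructure R
  let r : (relLang n).Relations n := ⟨(), rfl⟩
  exact Set.empty_definable_iff.mpr ⟨r.formula fun i => FirstOrder.Language.var i, by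
    ext v
    refine Iff.trans ?_ (FirstOrder.Language.Formula.realize_rel (M := ℤ × ℕ) (R := r)).symm
    exact Iff.rfl⟩

theorem DefFrom.isLocal [Finite α] (hR : IsLocal {v | R v}) (h : DefFrom R S) : IsLocal S := by
  let _ := relStructure R
  obtain ⟨φ, rfl⟩ := Set.empty_definable_iff.mp h
  obtain ⟨N, hN⟩ := isLocal_realize hR φ
  refine ⟨N, fun x y hxy => ?_⟩
  have hx : ∀ x : α → ℤ × ℕ, FirstOrder.Language.BoundedFormula.Realize φ
      (Sum.elim x (default : Fin 0 → ℤ × ℕ) ∘ Sum.inl)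
      (Sum.elim x (default : Fin 0 → ℤ × ℕ) ∘ Sum.inr) ↔ FirstOrder.Language.Formula.Realize φ x :=
    fun x => iff_of_eq
      (congrArg (FirstOrder.Language.BoundedFormula.Realize φ x) (Subsingleton.elim _ _))
  have := hN (Sum.elim x default) (Sum.elim y default) ?_
  · exact (hx x).symm.trans (this.trans (hx y))
  · rintro (i | i) (j | j) m hm
    · exact hxy i j m hm
    · exact j.elim0
    · exact i.elim0
    · exact i.elim0

end DefFrom

/-! ### Compactness for local relations -/

theorem IsLocal.exists_extend {ι : Type} [Finite ι] (y : ι → ℤ × ℕ) (F : Filter (ℤ × ℕ))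
    [F.NeBot] : ∃ w, ∀ S : Set (Option ι → ℤ × ℕ), IsLocal S →
      (∀ᶠ u in F, (fun o => o.elim u y) ∈ S) → (fun o => o.elim w y) ∈ S := by
  have hU : (Ultrafilter.of F : Filter (ℤ × ℕ)) ≤ F := Ultrafilter.of_le F
  generalize Ultrafilter.of F = U at hU
  by_cases h : ∃ i m, ∀ᶠ u in (U : Filter (ℤ × ℕ)), u = shiftBy (y i) m
  · obtain ⟨i, m, him⟩ := h
    refine ⟨shiftBy (y i) m, fun S _ hS => ?_⟩
    obtain ⟨u, hu, rfl⟩ := (Filter.Eventually.and (hU hS) him).exists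
    exact hu
  · push Not at h
    obtain ⟨g, hg⟩ := exists_fresh_galaxy y
    refine ⟨(0, g), fun S hloc hS => ?_⟩
    obtain ⟨N, hN⟩ := hloc
    have hfar : ∀ᶠ u in (U : Filter (ℤ × ℕ)), ∀ i, ∀ m ∈ Set.Icc (-(N : ℤ)) N,
        u ≠ shiftBy (y i) m := by
      rw [Filter.eventually_all]
      intro i
      rw [(Set.finite_Icc _ _).eventually_all]
      exact fun m _ => h i m
    obtain ⟨u, hu, hu'⟩ := (Filter.Eventually.and (hU hS) hfar).exists
    refine (hN _ _ ?_).mp hu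
    have hfresh : ∀ i m, ((0, g) : ℤ × ℕ) ≠ shiftBy (y i) m := fun i m e =>
      hg i (by simpa using (congrArg Prod.snd e).symm)
    rintro (_ | i) (_ | j) m hm
    · simp [eq_shiftBy_self]
    · exact iff_of_false (hu' j m (abs_le.mp hm)) (hfresh j m)
    · simp only [Option.elim_some, Option.elim_none]
      rw [eq_shiftBy_comm, eq_shiftBy_comm (b := (0, g))]
      rw [← abs_neg] at hm
      exact iff_of_false (hu' i (-m) (abs_le.mp hm)) (hfresh i (-m))
    · exact Iff.rfl

theorem exists_mem_of_isLocal {ι : Type} [Finite ι] (F : Filter (ι → ℤ × ℕ)) [F.NeBot] :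
    ∃ y, ∀ S ∈ F, IsLocal S → y ∈ S := by
  have hU : (Ultrafilter.of F : Filter (ι → ℤ × ℕ)) ≤ F := Ultrafilter.of_le F
  generalize Ultrafilter.of F = U at hU
  let D : ι → ι → ℤ → Prop := fun i j m => ∀ᶠ x in (U : Filter (ι → ℤ × ℕ)), x i = shiftBy (x j) m
  have hrefl : ∀ i, D i i 0 := fun i => by simp [D]
  have hsymm : ∀ {i j m}, D i j m → D j i (-m) := fun h => h.mono fun x hx => eq_shiftBy_comm.mp hx
  have htrans : ∀ {i j k m l}, D i j m → D j k l → D i k (l + m) := fun h h' => by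
    filter_upwards [h, h'] with x hx hx'
    rw [hx, hx', shiftBy_shiftBy]
  have huniq : ∀ {i j m l}, D i j m → D i j l → m = l := fun h h' => by
    obtain ⟨x, hx, hx'⟩ := (h.and h').exists
    exact shiftBy_inj.mp (hx.symm.trans hx')
  let s : Setoid ι := ⟨fun i j => ∃ m, D i j m, ⟨fun i => ⟨0, hrefl i⟩,
    fun ⟨m, h⟩ => ⟨-m, hsymm h⟩, fun ⟨m, h⟩ ⟨l, h'⟩ => ⟨l + m, htrans h h'⟩⟩⟩
  obtain ⟨e, he⟩ := Countable.exists_injective_nat (Quotient s)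
  have hrep : ∀ i, ∃ m, D i (Quotient.out (Quotient.mk s i)) m := fun i =>
    s.symm (Quotient.exact (Quotient.out_eq (Quotient.mk s i)))
  choose m hm using hrep
  let y : ι → ℤ × ℕ := fun i => (m i, e (Quotient.mk s i))
  have hy : ∀ i j l, D i j l ↔ y i = shiftBy (y j) l := by
    intro i j l
    have hquot : Quotient.mk s i = Quotient.mk s j → D i j (-m j + m i) := fun h => by
      have := hm i
      rw [h] at this
      exact htrans this (hsymm (hm j))
    constructor
    · intro h
      have hq : Quotient.mk s i = Quotient.mk s j := Quotient.sound ⟨l, h⟩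
      have := huniq h (hquot hq)
      simp only [y, shiftBy, hq, Prod.mk.injEq, and_true]
      omega
    · intro h
      simp only [y, shiftBy, Prod.mk.injEq] at h
      have := hquot (he h.2)
      rwa [h.1, neg_add_cancel_left] at this
  refine ⟨y, fun S hS hloc => ?_⟩
  obtain ⟨N, hN⟩ := hloc
  have hnear : ∀ᶠ x in (U : Filter (ι → ℤ × ℕ)), ∀ i j, ∀ l ∈ Set.Icc (-(N : ℤ)) N,
      (x i = shiftBy (x j) l ↔ y i = shiftBy (y j) l) := by
    rw [Filter.eventually_all]
    intro i
    rw [Filter.eventually_all]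
    intro j
    rw [(Set.finite_Icc _ _).eventually_all]
    intro l _
    by_cases h : D i j l
    · filter_upwards [h] with x hx
      exact iff_of_true hx ((hy i j l).mp h)
    · filter_upwards [Ultrafilter.eventually_not.mpr h] with x hx
      exact iff_of_false hx (mt (hy i j l).mpr h)
  obtain ⟨x, hx, hx'⟩ := ((Filter.Eventually.and (hU hS) hnear)).exists
  exact (hN x y fun i j l hl => hx' i j l (abs_le.mp hl)).mp hx

/-! ### Types over a relation and homogeneity -/

/-- The tuples `x` and `y` belong to the same sets definable from `R`. -/
def TypeEq {n : ℕ} (R : (Fin n → ℤ × ℕ) → Prop) {α : Type} (x y : α → ℤ × ℕ) : Prop :=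
  ∀ S : Set (α → ℤ × ℕ), DefFrom R S → x ∈ S → y ∈ S

section TypeEq

variable {n : ℕ} {R : (Fin n → ℤ × ℕ) → Prop} {α β : Type} {x y : α → ℤ × ℕ}

theorem TypeEq.symm (h : TypeEq R x y) : TypeEq R y x := fun S hS hy =>
  by_contra fun hx => h Sᶜ hS.compl hx hy

theorem TypeEq.comp (h : TypeEq R x y) (f : β → α) : TypeEq R (x ∘ f) (y ∘ f) :=
  fun _ hS hx => h _ (hS.preimage_comp f) hx

theorem TypeEq.eq_iff (h : TypeEq R x y) (i j : α) : x i = x j ↔ y i = y j :=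
  ⟨fun e => h _ (defFrom_eq i j) e, fun e => h.symm _ (defFrom_eq i j) e⟩

theorem typeEq_of_diff_eq [Finite α] (hR : IsLocal {v | R v})
    (h : ∀ i j, ∀ m : ℤ, x i = shiftBy (x j) m ↔ y i = shiftBy (y j) m) : TypeEq R x y := by
  intro S hS hx
  obtain ⟨N, hN⟩ := hS.isLocal hR
  exact (hN x y fun i j m _ => h i j m).mp hx

theorem TypeEq.exists_extend [Finite α] (hR : IsLocal {v | R v}) (h : TypeEq R x y) (u : ℤ × ℕ) :
    ∃ w, TypeEq R (fun o : Option α => o.elim u x) (fun o => o.elim w y) := by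
  let F : Filter (ℤ × ℕ) :=
    { sets := {A | ∃ S : Set (Option α → ℤ × ℕ), DefFrom R S ∧ (fun o : Option α => o.elim u x) ∈ S ∧
        {w | (fun o : Option α => o.elim w y) ∈ S} ⊆ A}
      univ_sets := ⟨Set.univ, defFrom_univ, trivial, Set.subset_univ _⟩
      sets_of_superset := fun ⟨S, h₁, h₂, h₃⟩ hAB => ⟨S, h₁, h₂, h₃.trans hAB⟩
      inter_sets := fun ⟨S, h₁, h₂, h₃⟩ ⟨T, h₁', h₂', h₃'⟩ =>
        ⟨S ∩ T, h₁.inter h₁', ⟨h₂, h₂'⟩, fun w hw => ⟨h₃ hw.1, h₃' hw.2⟩⟩ }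
  have : F.NeBot := by
    refine Filter.forall_mem_nonempty_iff_neBot.mp fun A hA => ?_
    obtain ⟨S, h₁, h₂, h₃⟩ := hA
    obtain ⟨z, hz, hzy⟩ := h _ (h₁.image_comp some) ⟨_, h₂, rfl⟩
    refine ⟨z none, h₃ ?_⟩
    have : (fun o : Option α => o.elim (z none) y) = z := by
      funext o
      cases o with
      | none => rfl
      | some i => exact (congrFun hzy i).symm
    simpa only [Set.mem_ofPred_eq, this] using hz
  obtain ⟨w, hw⟩ := IsLocal.exists_extend y F
  exact ⟨w, fun S hS hx => hw S (hS.isLocal hR) ⟨S, hS, hx, subset_rfl⟩⟩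

end TypeEq

/-- A set of pairs is a partial elementary map if it maps tuples to tuples of the same type. -/
def IsElemMap {n : ℕ} (R : (Fin n → ℤ × ℕ) → Prop) (p : Set ((ℤ × ℕ) × (ℤ × ℕ))) : Prop :=
  ∀ (α : Type) (_ : Finite α) (z : α → (ℤ × ℕ) × (ℤ × ℕ)), (∀ i, z i ∈ p) →
    TypeEq R (Prod.fst ∘ z) (Prod.snd ∘ z)

theorem IsElemMap.exists_insert {n : ℕ} {R : (Fin n → ℤ × ℕ) → Prop} (hR : IsLocal {v | R v})
    {p : Set ((ℤ × ℕ) × (ℤ × ℕ))} (hfin : p.Finite) (hp : IsElemMap R p) (u : ℤ × ℕ) :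
    ∃ w, IsElemMap R (insert (u, w) p) := by
  have := hfin.to_subtype
  obtain ⟨w, hw⟩ := (hp p inferInstance Subtype.val Subtype.prop).exists_extend hR u
  refine ⟨w, fun α _ z hz => ?_⟩
  have hf : ∀ i, ∃ o : Option p, z i = o.elim (u, w) Subtype.val := fun i => by
    rcases hz i with h | h
    · exact ⟨none, h⟩
    · exact ⟨some ⟨z i, h⟩, rfl⟩
  choose f hf using hf
  have key := hw.comp f
  convert key using 1 <;> funext i <;> simp only [Function.comp_apply, hf] <;> cases f i <;> rfl

theorem IsElemMap.swap {n : ℕ} {R : (Fin n → ℤ × ℕ) → Prop}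
    {p : Set ((ℤ × ℕ) × (ℤ × ℕ))} (hp : IsElemMap R p) : IsElemMap R (Prod.swap ⁻¹' p) :=
  fun α hα z hz => (hp α hα (Prod.swap ∘ z) hz).symm

theorem IsElemMap.mono {n : ℕ} {R : (Fin n → ℤ × ℕ) → Prop}
    {p q : Set ((ℤ × ℕ) × (ℤ × ℕ))} (hp : IsElemMap R p) (h : q ⊆ p) : IsElemMap R q :=
  fun α hα z hz => hp α hα z fun i => h (hz i)

theorem IsElemMap.exists_insert' {n : ℕ} {R : (Fin n → ℤ × ℕ) → Prop} (hR : IsLocal {v | R v})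
    {p : Set ((ℤ × ℕ) × (ℤ × ℕ))} (hfin : p.Finite) (hp : IsElemMap R p) (w : ℤ × ℕ) :
    ∃ u, IsElemMap R (insert (u, w) p) := by
  obtain ⟨u, hu⟩ := hp.swap.exists_insert hR (hfin.preimage Prod.swap_injective.injOn) w
  refine ⟨u, hu.swap.mono ?_⟩
  rintro z (rfl | hz)
  · exact Or.inl rfl
  · exact Or.inr hz

/-- Tuples of the same type are conjugate under the permutations preserving the relation. -/
theorem TypeEq.exists_perm {n : ℕ} {R : (Fin n → ℤ × ℕ) → Prop} (hR : IsLocal {v | R v})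
    {α : Type} [Finite α] {x y : α → ℤ × ℕ} (h : TypeEq R x y) :
    ∃ g ∈ GammaR R, ∀ i, g (x i) = y i := by
  classical
  let P := {p : Set ((ℤ × ℕ) × (ℤ × ℕ)) // p.Finite ∧ IsElemMap R p}
  let p₀ : P := ⟨Set.range fun i => (x i, y i), Set.finite_range _, fun β _ z hz => by
    choose f hf using hz
    have := h.comp f
    convert this using 1 <;> funext i <;> simp [← hf]⟩
  let 𝒟 : (ℤ × ℕ) ⊕ (ℤ × ℕ) → Order.Cofinal P := fun c => match c with
    | Sum.inl u => ⟨{p | ∃ w, (u, w) ∈ p.1}, fun p => by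
        obtain ⟨w, hw⟩ := p.2.2.exists_insert hR p.2.1 u
        exact ⟨⟨_, p.2.1.insert _, hw⟩, ⟨w, Or.inl rfl⟩, Set.subset_insert _ _⟩⟩
    | Sum.inr w => ⟨{p | ∃ u, (u, w) ∈ p.1}, fun p => by
        obtain ⟨u, hu⟩ := p.2.2.exists_insert' hR p.2.1 w
        exact ⟨⟨_, p.2.1.insert _, hu⟩, ⟨u, Or.inl rfl⟩, Set.subset_insert _ _⟩⟩
  let I := Order.idealOfCofinals p₀ 𝒟
  have hfun : ∀ u, ∃ w, ∃ p ∈ I, (u, w) ∈ p.1 := fun u => by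
    obtain ⟨p, ⟨w, hw⟩, hp⟩ := Order.cofinal_meets_idealOfCofinals p₀ 𝒟 (Sum.inl u)
    exact ⟨w, p, hp, hw⟩
  have hsurj : ∀ w, ∃ u, ∃ p ∈ I, (u, w) ∈ p.1 := fun w => by
    obtain ⟨p, ⟨u, hu⟩, hp⟩ := Order.cofinal_meets_idealOfCofinals p₀ 𝒟 (Sum.inr w)
    exact ⟨u, p, hp, hu⟩
  have hdir : ∀ {β : Type} [Finite β] (z : β → (ℤ × ℕ) × (ℤ × ℕ)), (∀ i, ∃ p ∈ I, z i ∈ p.1) →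
      TypeEq R (Prod.fst ∘ z) (Prod.snd ∘ z) := by
    intro β _ z hz
    choose p hpI hzp using hz
    have : Nonempty (I : Set P) := I.nonempty.to_subtype
    obtain ⟨q, hq⟩ := (directedOn_iff_directed.mp I.directed).finite_le
      fun i => (⟨p i, hpI i⟩ : (I : Set P))
    exact q.1.2.2 β inferInstance z fun i => hq i (hzp i)
  choose f hf using hfun
  choose g hg using hsurj
  have hiff : ∀ {u u' w w'}, (∃ p ∈ I, (u, w) ∈ p.1) → (∃ p ∈ I, (u', w') ∈ p.1) →
      (u = u' ↔ w = w') := fun {u u' w w'} h h' => by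
    have := hdir (fun b : Bool => bif b then (u, w) else (u', w')) (by rintro (_ | _) <;> assumption)
    exact this.eq_iff true false
  let γ : Equiv.Perm (ℤ × ℕ) := ⟨f, g, fun u => (hiff (hg (f u)) (hf u)).mpr rfl,
    fun w => (hiff (hf (g w)) (hg w)).mp rfl⟩
  refine ⟨γ, fun v => ?_, fun i => ?_⟩
  · have := hdir (fun i => (v i, f (v i))) fun i => hf (v i)
    exact ⟨fun h => this.symm _ defFrom_self h, fun h => this _ defFrom_self h⟩
  · exact (hiff (hf (x i)) ⟨p₀, Order.mem_idealOfCofinals p₀ 𝒟, i, rfl⟩).mp rfl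

/-- A local relation invariant under all the permutations preserving the local relation `R` is
definable from `R`. -/
theorem definableBy_of_preserves {n k : ℕ} {R : (Fin n → ℤ × ℕ) → Prop}
    {Q : (Fin k → ℤ × ℕ) → Prop} (hR : IsLocal {v | R v}) (hQ : IsLocal {v | Q v})
    (h : ∀ g ∈ GammaR R, Preserves g Q) : DefinableBy R Q := by
  classical
  rw [definableBy_iff]
  by_contra hdef
  let X : {S : Set (Fin k → ℤ × ℕ) // DefFrom R S} → Set (Fin k ⊕ Fin k → ℤ × ℕ) :=
    fun S => {z | z ∘ Sum.inl ∈ S.1 ↔ z ∘ Sum.inr ∈ S.1}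
  let Y : Set (Fin k ⊕ Fin k → ℤ × ℕ) := {z | Q (z ∘ Sum.inl)} ∩ {z | Q (z ∘ Sum.inr)}ᶜ
  let F : Filter (Fin k ⊕ Fin k → ℤ × ℕ) := Filter.principal Y ⊓ ⨅ S, Filter.principal (X S)
  have hne : F.NeBot := by
    refine Filter.forall_mem_nonempty_iff_neBot.mp fun A hA => ?_
    obtain ⟨B, hB, C, hC, rfl⟩ := Filter.mem_inf_iff.mp hA
    obtain ⟨t, ht, htC⟩ := (Filter.hasBasis_iInf_principal_finite X).mem_iff.mp hC
    by_contra hempty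
    rw [Set.not_nonempty_iff_eq_empty] at hempty
    have hagree : ∀ x y : Fin k → ℤ × ℕ, Q x → (∀ S ∈ t, x ∈ S.1 ↔ y ∈ S.1) → Q y := by
      intro x y hx hxy
      by_contra hy
      have hmem : Sum.elim x y ∈ B ∩ C := ⟨hB ⟨hx, hy⟩, htC (Set.mem_iInter₂.mpr hxy)⟩
      rw [hempty] at hmem
      exact hmem
    apply hdef
    have := ht.to_subtype
    let atom : (t → Prop) → Set (Fin k → ℤ × ℕ) := fun c => ⋂ S : t, {x | x ∈ S.1.1 ↔ c S}
    have hatom : ∀ c, DefFrom R (atom c) := fun c => DefFrom.iInter fun S => by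
      by_cases hc : c S
      · simpa [hc] using S.1.2
      · simp only [hc, iff_false]
        exact S.1.2.compl
    have hcover : {v | Q v} = ⋃ c : {c : t → Prop // ∃ x ∈ atom c, Q x}, atom c.1 := by
      ext v
      rw [Set.mem_iUnion]
      constructor
      · intro hv
        have hv' : v ∈ atom fun S => v ∈ S.1.1 := Set.mem_iInter.mpr fun S => Iff.rfl
        exact ⟨⟨_, v, hv', hv⟩, hv'⟩
      · rintro ⟨⟨c, x, hx, hQx⟩, hv⟩
        refine hagree x v hQx fun S hS => ?_
        exact (Set.mem_iInter.mp hx ⟨S, hS⟩).trans (Set.mem_iInter.mp hv ⟨S, hS⟩).symm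
    rw [hcover]
    exact DefFrom.iUnion fun c => hatom c.1
  obtain ⟨z, hz⟩ := exists_mem_of_isLocal F
  have hzY : z ∈ Y := hz Y (Filter.mem_inf_of_left (Filter.mem_principal_self Y))
    ((hQ.preimage_comp Sum.inl).inter (hQ.preimage_comp Sum.inr).compl)
  have hz' : TypeEq R (z ∘ Sum.inl) (z ∘ Sum.inr) := by
    intro S hS hx
    have hl := (hS.isLocal hR).preimage_comp (Sum.inl : Fin k → Fin k ⊕ Fin k)
    have hr := (hS.isLocal hR).preimage_comp (Sum.inr : Fin k → Fin k ⊕ Fin k)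
    have hX : IsLocal (X ⟨S, hS⟩) := by
      refine (congrArg IsLocal (Set.ext fun z => ?_)).mpr
        ((hl.inter hr).union (hl.compl.inter hr.compl))
      exact iff_iff_and_or_not_and_not
    exact (hz (X ⟨S, hS⟩) (Filter.mem_inf_of_right (Filter.mem_iInf_of_mem _
      (Filter.mem_principal_self _))) hX).mp hx
  obtain ⟨g, hg, hgz⟩ := hz'.exists_perm hR
  refine hzY.2 ?_
  have := (h g hg (z ∘ Sum.inl)).mpr hzY.1
  rwa [show ⇑g ∘ z ∘ Sum.inl = z ∘ Sum.inr from funext hgz] at this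


/-! ### Shifts -/

theorem IsShift.apply_shiftBy {s : Equiv.Perm (ℤ × ℕ)} (hs : IsShift s) (a : ℤ × ℕ) (m : ℤ) :
    s (shiftBy a m) = shiftBy (s a) m := by
  rw [← diff_eq_coe, hs, diff_eq_coe]

theorem IsShift.eq_shiftBy_iff {s : Equiv.Perm (ℤ × ℕ)} (hs : IsShift s) (a b : ℤ × ℕ) (m : ℤ) :
    s a = shiftBy (s b) m ↔ a = shiftBy b m := by
  rw [← hs.apply_shiftBy, s.injective.eq_iff]

theorem isShift_of_mem_gammaR_succRel {s : Equiv.Perm (ℤ × ℕ)} (hs : s ∈ GammaR succRel) :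
    IsShift s := by
  have h1 : ∀ a, s (shiftBy a 1) = shiftBy (s a) 1 := fun a =>
    (hs ![a, shiftBy a 1]).mpr rfl
  have hm : ∀ (m : ℤ) (a), s (shiftBy a m) = shiftBy (s a) m := by
    intro m
    induction m with
    | zero => simp
    | succ i ih => intro a; rw [← shiftBy_shiftBy, h1, ih, shiftBy_shiftBy]
    | pred i ih =>
      intro a
      rw [← shiftBy_left_inj (m := 1), ← h1, shiftBy_shiftBy, shiftBy_shiftBy, sub_add_cancel, ih]
  have key : ∀ a b (m : ℤ), s a = shiftBy (s b) m ↔ a = shiftBy b m := fun a b m => by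
    rw [← hm, s.injective.eq_iff]
  intro a b
  cases h : diff a b with
  | coe m => rwa [diff_eq_coe, key, ← diff_eq_coe]
  | top =>
    rw [diff_eq_top] at h ⊢
    intro h'
    rw [(key _ _ _).mp (eq_shiftBy_of_snd_eq h'), shiftBy_snd] at h
    exact h rfl

/-- Tuples with the same differences are related by a shift. -/
theorem exists_isShift {ι : Type} [Finite ι] {x y : ι → ℤ × ℕ}
    (h : ∀ i j, ∀ m : ℤ, x i = shiftBy (x j) m ↔ y i = shiftBy (y j) m) :
    ∃ s, IsShift s ∧ ∀ i, s (x i) = y i := by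
  obtain ⟨g, hg, hxy⟩ := (typeEq_of_diff_eq isLocal_succRel h).exists_perm isLocal_succRel
  exact ⟨g, isShift_of_mem_gammaR_succRel hg, hxy⟩

theorem exists_isShift_apply_eq (a b : ℤ × ℕ) : ∃ s, IsShift s ∧ s a = b := by
  obtain ⟨s, hs, h⟩ := exists_isShift (ι := Unit) (x := fun _ => a) (y := fun _ => b)
    (by simp [eq_shiftBy_self])
  exact ⟨s, hs, h ()⟩

/-- The set `Γ_R` as a subgroup. -/
def gammaSubgroup {n : ℕ} (R : (Fin n → ℤ × ℕ) → Prop) : Subgroup (Equiv.Perm (ℤ × ℕ)) where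
  carrier := GammaR R
  one_mem' _ := Iff.rfl
  mul_mem' {f g} hf hg v := (hf (g ∘ v)).trans (hg v)
  inv_mem' {f} hf v := by
    have := hf (⇑f⁻¹ ∘ v)
    rw [← Function.comp_assoc, ← Equiv.Perm.coe_mul, mul_inv_cancel, Equiv.Perm.coe_one,
      Function.id_comp] at this
    exact this.symm

theorem IsShift.preserves {n : ℕ} {R : (Fin n → ℤ × ℕ) → Prop} (hR : IsLocal {v | R v})
    {s : Equiv.Perm (ℤ × ℕ)} (hs : IsShift s) : Preserves s R := by
  obtain ⟨N, hN⟩ := hR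
  exact fun v => hN _ _ fun i j m _ => hs.eq_shiftBy_iff _ _ _

/-! ### Regular integers -/

section Regular

variable {Γ : Subgroup (Equiv.Perm (ℤ × ℕ))}

/-- The integers of `KSet Γ m`. -/
def intK (Γ : Subgroup (Equiv.Perm (ℤ × ℕ))) (m : ℤ) : Set ℤ :=
  {k | ∃ γ ∈ Γ, ∃ b, γ (shiftBy b m) = shiftBy (γ b) k}

theorem coe_mem_kSet {m k : ℤ} : (k : WithTop ℤ) ∈ KSet Γ (m : WithTop ℤ) ↔ k ∈ intK Γ m := by
  simp only [KSet, intK, Set.mem_ofPred_eq, diff_eq_coe, SetLike.mem_coe]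
  constructor
  · rintro ⟨γ, hγ, a, b, rfl, h⟩
    exact ⟨γ, hγ, b, h⟩
  · rintro ⟨γ, hγ, b, h⟩
    exact ⟨γ, hγ, _, b, rfl, h⟩

theorem top_mem_kSet {m : ℤ} :
    ⊤ ∈ KSet Γ (m : WithTop ℤ) ↔ ∃ γ ∈ Γ, ∃ b, (γ (shiftBy b m)).2 ≠ (γ b).2 := by
  simp only [KSet, Set.mem_ofPred_eq, diff_eq_coe, SetLike.mem_coe, diff_eq_top]
  constructor
  · rintro ⟨γ, hγ, a, b, rfl, h⟩
    exact ⟨γ, hγ, b, h⟩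
  · rintro ⟨γ, hγ, b, h⟩
    exact ⟨γ, hγ, _, b, rfl, h⟩

theorem regular_iff {m : ℤ} : Regular Γ m ↔
    (intK Γ m).Finite ∧ ∀ γ ∈ Γ, ∀ b, (γ (shiftBy b m)).2 = (γ b).2 := by
  unfold Regular
  rw [top_mem_kSet]
  push Not
  refine and_congr_left fun h => ⟨fun hf => ?_, fun hf => ?_⟩
  · refine (hf.preimage (f := ((↑) : ℤ → WithTop ℤ)) WithTop.coe_injective.injOn).subset ?_
    exact fun k hk => coe_mem_kSet.mpr hk
  · refine (hf.image ((↑) : ℤ → WithTop ℤ)).subset fun k hk => ?_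
    cases k with
    | coe k => exact ⟨k, coe_mem_kSet.mp hk, rfl⟩
    | top =>
      obtain ⟨γ, hγ, b, hb⟩ := top_mem_kSet.mp hk
      exact absurd (h γ hγ b) hb

theorem Regular.exists_eq {m : ℤ} (h : Regular Γ m) {γ : Equiv.Perm (ℤ × ℕ)} (hγ : γ ∈ Γ)
    (b : ℤ × ℕ) : ∃ k ∈ intK Γ m, γ (shiftBy b m) = shiftBy (γ b) k :=
  have := eq_shiftBy_of_snd_eq ((regular_iff.mp h).2 γ hγ b)
  ⟨_, ⟨γ, hγ, b, this⟩, this⟩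

theorem regular_of_finite {m : ℤ} {F : Set ℤ} (hF : F.Finite)
    (h : ∀ γ ∈ Γ, ∀ b, ∃ k ∈ F, γ (shiftBy b m) = shiftBy (γ b) k) : Regular Γ m := by
  refine regular_iff.mpr ⟨hF.subset ?_, fun γ hγ b => ?_⟩
  · rintro k ⟨γ, hγ, b, hb⟩
    obtain ⟨k', hk', e⟩ := h γ hγ b
    rw [hb, shiftBy_inj] at e
    exact e ▸ hk'
  · obtain ⟨k, -, e⟩ := h γ hγ b
    rw [e, shiftBy_snd]

/-- The subgroup of regular integers. -/
def regularSubgroup (Γ : Subgroup (Equiv.Perm (ℤ × ℕ))) : AddSubgroup ℤ where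
  carrier := {m | Regular Γ m}
  zero_mem' := regular_of_finite (Set.finite_singleton 0) fun γ _ b => ⟨0, rfl, by simp⟩
  add_mem' {m m'} hm hm' := by
    refine regular_of_finite ((regular_iff.mp hm).1.add (regular_iff.mp hm').1) fun γ hγ b => ?_
    obtain ⟨k, hk, e⟩ := Regular.exists_eq hm hγ b
    obtain ⟨k', hk', e'⟩ := Regular.exists_eq hm' hγ (shiftBy b m)
    refine ⟨k + k', Set.add_mem_add hk hk', ?_⟩
    rw [← shiftBy_shiftBy, e', e, shiftBy_shiftBy]
  neg_mem' {m} hm := by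
    refine regular_of_finite (regular_iff.mp hm).1.neg fun γ hγ b => ?_
    obtain ⟨k, hk, e⟩ := Regular.exists_eq hm hγ (shiftBy b (-m))
    refine ⟨-k, Set.neg_mem_neg.mpr hk, ?_⟩
    rw [shiftBy_shiftBy, neg_add_cancel, shiftBy_zero] at e
    exact eq_shiftBy_comm.mp e

theorem regular_iff_dvd {d : ℤ} (hdvd : ∀ z : ℤ, Regular Γ z → d ∣ z)
    (hgreatest : ∀ e : ℤ, (∀ z : ℤ, Regular Γ z → e ∣ z) → e ∣ d) {z : ℤ} :
    Regular Γ z ↔ d ∣ z := by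
  refine ⟨hdvd z, fun h => ?_⟩
  obtain ⟨e, he⟩ := Int.subgroup_cyclic (regularSubgroup Γ)
  have hmem : ∀ z, Regular Γ z ↔ e ∣ z := fun z => by
    rw [← Int.mem_zmultiples_iff, AddSubgroup.zmultiples_eq_closure, ← he]
    rfl
  rw [hmem]
  exact (hgreatest e fun z hz => (hmem z).mp hz).trans h

variable (hΓ : ∀ s, IsShift s → s ∈ Γ)
include hΓ

theorem exists_apply_eq_of_mem_intK {m k : ℤ} (hk : k ∈ intK Γ m)
    {γ : Equiv.Perm (ℤ × ℕ)} (hγ : γ ∈ Γ) (b : ℤ × ℕ) :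
    ∃ a, ∃ γ' ∈ Γ, γ' (shiftBy a m) = γ (shiftBy b k) ∧ γ' a = γ b := by
  obtain ⟨γ', hγ', a, ha⟩ := hk
  obtain ⟨s, hs, hsb⟩ := exists_isShift_apply_eq (γ' a) b
  refine ⟨a, γ * s * γ', Γ.mul_mem (Γ.mul_mem hγ (hΓ s hs)) hγ', ?_, ?_⟩
  · simp [ha, hs.apply_shiftBy, hsb]
  · simp [hsb]

theorem Regular.exists_of_mem_intK {m k : ℤ} (hm : Regular Γ m) (hk : k ∈ intK Γ m)
    {γ : Equiv.Perm (ℤ × ℕ)} (hγ : γ ∈ Γ) (b : ℤ × ℕ) :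
    ∃ k' ∈ intK Γ m, γ (shiftBy b k) = shiftBy (γ b) k' := by
  obtain ⟨a, γ', hγ', h₁, h₂⟩ := exists_apply_eq_of_mem_intK hΓ hk hγ b
  rw [← h₁, ← h₂]
  exact hm.exists_eq hγ' a

theorem Regular.of_mem_intK {m k : ℤ} (hm : Regular Γ m) (hk : k ∈ intK Γ m) : Regular Γ k :=
  regular_of_finite (regular_iff.mp hm).1 fun _ hγ b => hm.exists_of_mem_intK hΓ hk hγ b

theorem Regular.coeff_sum_pow_eq {m : ℤ} {F : Finset ℤ} (hm : Regular Γ m)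
    (hF : ∀ k, k ∈ F ↔ k ∈ intK Γ m) (A : Type) [CommRing A] (i : ℕ) :
    ∀ {γ : Equiv.Perm (ℤ × ℕ)}, γ ∈ Γ → ∀ {b : ℤ × ℕ} {j j' : ℤ},
      γ (shiftBy b j) = shiftBy (γ b) j' →
      ((∑ k ∈ F, LaurentPolynomial.T k : LaurentPolynomial A) ^ i).coeff j =
        ((∑ k ∈ F, LaurentPolynomial.T k : LaurentPolynomial A) ^ i).coeff j' := by
  have hcoeff : ∀ (f : LaurentPolynomial A) (j : ℤ),
      ((∑ k ∈ F, LaurentPolynomial.T k) * f).coeff j = ∑ k ∈ F, f.coeff (j - k) := fun f j => by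
    rw [Finset.sum_mul, AddMonoidAlgebra.coeff_sum, Finsupp.finsetSum_apply]
    refine Finset.sum_congr rfl fun k _ => ?_
    rw [LaurentPolynomial.T, AddMonoidAlgebra.coeff_single_mul_apply, one_mul, neg_add_eq_sub]
  induction i with
  | zero =>
    intro γ hγ b j j' h
    have : j = 0 ↔ j' = 0 := by
      rw [← eq_shiftBy_self (a := b), ← eq_shiftBy_self (a := γ b), ← h, γ.injective.eq_iff]
    rw [pow_zero, ← LaurentPolynomial.T_zero]
    simp only [LaurentPolynomial.T_apply, eq_comm (a := (0 : ℤ)), this]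
  | succ i ih =>
    intro γ hγ b j j' h
    rw [pow_succ', hcoeff, hcoeff]
    have himg : ∀ k ∈ F, ∃ k' ∈ F, γ (shiftBy b k) = shiftBy (γ b) k' := fun k hk => by
      obtain ⟨k', hk', e⟩ := hm.exists_of_mem_intK hΓ ((hF k).mp hk) hγ b
      exact ⟨k', (hF k').mpr hk', e⟩
    choose f hfF hf using himg
    refine Finset.sum_bij f hfF (fun k hk k' hk' e => ?_) (fun k hk => ?_) fun k hk => ?_
    · have := hf k hk
      rw [e, ← hf k' hk', γ.injective.eq_iff, shiftBy_inj] at this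
      exact this
    · obtain ⟨k', hk', e⟩ := hm.exists_of_mem_intK hΓ ((hF k).mp hk) (Γ.inv_mem hγ) (γ b)
      refine ⟨k', (hF k').mpr hk', ?_⟩
      have := hf k' ((hF k').mpr hk')
      rw [Equiv.Perm.inv_eq_iff_eq, show γ⁻¹ (γ b) = b by simp] at e
      rwa [← e, shiftBy_inj, eq_comm] at this
    · refine ih hγ (b := shiftBy b k) ?_
      rw [hf k hk, shiftBy_shiftBy, shiftBy_shiftBy, add_sub_cancel, add_sub_cancel, h]

theorem Regular.exists_prime_mul {m : ℤ} (hm : Regular Γ m) {p : ℕ} (hp : p.Prime) {j : ℤ}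
    (hj : j ∈ intK Γ (p * m)) : ∃ k ∈ intK Γ m, j = p * k := by
  have : Fact p.Prime := ⟨hp⟩
  have hfin := (regular_iff.mp hm).1
  have hF : ∀ k, k ∈ hfin.toFinset ↔ k ∈ intK Γ m := fun k => hfin.mem_toFinset
  generalize hfin.toFinset = F at hF
  have : CharP (LaurentPolynomial (ZMod p)) p :=
    charP_of_injective_algebraMap (algebraMap (ZMod p) (LaurentPolynomial (ZMod p))).injective p
  obtain ⟨γ, hγ, b, e⟩ := hj
  have hpow : ∀ i : ℤ, ((∑ k ∈ F, LaurentPolynomial.T k : LaurentPolynomial (ZMod p)) ^ p).coeff i =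
      ∑ k ∈ F, if p * k = i then 1 else 0 := fun i => by
    rw [sum_pow_char, AddMonoidAlgebra.coeff_sum, Finsupp.finsetSum_apply]
    simp only [LaurentPolynomial.T_pow, LaurentPolynomial.T_apply]
  have key := hm.coeff_sum_pow_eq hΓ hF (ZMod p) p hγ e
  have hp0 : (p : ℤ) ≠ 0 := by exact_mod_cast hp.ne_zero
  have hmF : m ∈ F := (hF m).mpr ⟨1, Γ.one_mem, b, rfl⟩
  rw [hpow, hpow] at key
  simp only [mul_right_inj' hp0, Finset.sum_ite_eq', hmF, if_true] at key
  by_contra! hne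
  rw [Finset.sum_eq_zero fun k hk => if_neg fun h => hne k ((hF k).mp hk) h.symm] at key
  exact one_ne_zero key

theorem Regular.exists_mul {m : ℤ} (hm : Regular Γ m) {N : ℕ} (hN : N ≠ 0) {j : ℤ}
    (hj : j ∈ intK Γ (N * m)) : ∃ k ∈ intK Γ m, j = N * k := by
  induction N using induction_on_primes generalizing j with
  | zero => exact absurd rfl hN
  | one => exact ⟨j, by simpa using hj, by simp⟩
  | prime_mul p a hp ih =>
    have hreg : a • m ∈ regularSubgroup Γ := AddSubgroup.nsmul_mem _ hm a
    rw [nsmul_eq_mul] at hreg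
    rw [Nat.cast_mul, mul_assoc] at hj
    obtain ⟨k, hk, rfl⟩ := Regular.exists_prime_mul hΓ hreg hp hj
    obtain ⟨l, hl, rfl⟩ := ih (right_ne_zero_of_mul hN) hk
    exact ⟨l, hl, by push_cast; ring⟩

/-- If `d` generates the group of regular integers, then elements of `Γ` preserve the relation
`|a - b| = d`. -/
theorem apply_shiftBy_eq_or {d : ℤ} (hd : d ≠ 0) (hreg : ∀ z, Regular Γ z ↔ d ∣ z)
    {γ : Equiv.Perm (ℤ × ℕ)} (hγ : γ ∈ Γ) (b : ℤ × ℕ) :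
    γ (shiftBy b d) = shiftBy (γ b) d ∨ γ (shiftBy b d) = shiftBy (γ b) (-d) := by
  have hreg_d : Regular Γ d := (hreg d).mpr dvd_rfl
  obtain ⟨e, he, h⟩ := hreg_d.exists_eq hγ b
  obtain ⟨q, rfl⟩ := (hreg e).mp (hreg_d.of_mem_intK hΓ he)
  have hq : q ≠ 0 := by
    rintro rfl
    rw [mul_zero, shiftBy_zero, γ.injective.eq_iff, eq_comm, eq_shiftBy_self] at h
    exact hd h
  have hmul : ∀ j ∈ intK Γ (q.natAbs * d), ↑q.natAbs * d ∣ j := fun j hj => by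
    obtain ⟨k, hk, rfl⟩ := hreg_d.exists_mul hΓ (Int.natAbs_ne_zero.mpr hq) hj
    exact mul_dvd_mul_left _ ((hreg k).mp (hreg_d.of_mem_intK hΓ hk))
  have hdvd : ↑q.natAbs * d ∣ d := by
    rcases Int.natAbs_eq q with hq' | hq'
    · refine hmul d ⟨γ⁻¹, Γ.inv_mem hγ, γ b, ?_⟩
      rw [← hq', mul_comm, ← h]
      simp
    · rw [← dvd_neg]
      refine hmul (-d) ⟨γ⁻¹, Γ.inv_mem hγ, γ (shiftBy b d), ?_⟩
      nth_rewrite 1 [h]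
      rw [shiftBy_shiftBy, show d * q + q.natAbs * d = 0 by rw [hq']; simp; ring]
      simp
  have hone : q.natAbs = 1 := by
    have := Int.natAbs_dvd_natAbs.mpr hdvd
    rw [Int.natAbs_mul, Int.natAbs_natCast] at this
    have h2 := Nat.le_of_dvd (Int.natAbs_pos.mpr hd) this
    have h3 := Int.natAbs_pos.mpr hd
    have h4 := Int.natAbs_pos.mpr hq
    nlinarith
  rcases Int.natAbs_eq_iff.mp hone with rfl | rfl <;> simp [h]

end Regular

/-! ### Separating the elements of a galaxy -/

theorem DefFrom.comp_mem {n : ℕ} {R : (Fin n → ℤ × ℕ) → Prop} {α : Type} {S : Set (α → ℤ × ℕ)}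
    (hS : DefFrom R S) {γ : Equiv.Perm (ℤ × ℕ)} (hγ : γ ∈ GammaR R) {x : α → ℤ × ℕ} (hx : x ∈ S) :
    ⇑γ ∘ x ∈ S := by
  let _ := relStructure R
  obtain ⟨φ, rfl⟩ := Set.empty_definable_iff.mp hS
  let e : (relLang n).Equiv (ℤ × ℕ) (ℤ × ℕ) :=
    { γ with
      map_fun' := fun f => f.elim
      map_rel' := fun r y => hγ fun j => y (Fin.cast r.2 j) }
  exact (FirstOrder.Language.StrongHomClass.realize_formula e φ).mpr hx

theorem exists_snd_ne_of_not_regular {n : ℕ} {R : (Fin n → ℤ × ℕ) → Prop}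
    (hR : IsLocal {v | R v}) {z : ℤ} (hz : ¬ Regular (gammaSubgroup R) z) (b : ℤ × ℕ) :
    ∃ γ ∈ gammaSubgroup R, (γ (shiftBy b z)).2 ≠ (γ b).2 := by
  have hΓ : ∀ s, IsShift s → s ∈ gammaSubgroup R := fun s hs => hs.preserves hR
  suffices h : ∃ γ ∈ gammaSubgroup R, ∃ b, (γ (shiftBy b z)).2 ≠ (γ b).2 by
    obtain ⟨γ, hγ, b', h⟩ := h
    obtain ⟨s, hs, rfl⟩ := exists_isShift_apply_eq b b'
    exact ⟨γ * s, Subgroup.mul_mem _ hγ (hΓ s hs), by simpa [hs.apply_shiftBy] using h⟩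
  by_contra! hsame
  have hinf : (intK (gammaSubgroup R) z).Infinite := fun hfin => hz (regular_iff.mpr ⟨hfin, hsame⟩)
  have hex : ∀ N : ℕ, ∃ γ ∈ gammaSubgroup R, ∀ m : ℤ, |m| ≤ N →
      γ (shiftBy b z) ≠ shiftBy (γ b) m := fun N => by
    obtain ⟨k, ⟨γ, hγ, b', h⟩, hk⟩ := hinf.exists_notMem_finset (Finset.Icc (-(N : ℤ)) N)
    obtain ⟨s, hs, rfl⟩ := exists_isShift_apply_eq b b'
    refine ⟨γ * s, Subgroup.mul_mem _ hγ (hΓ s hs), fun m hm e => hk ?_⟩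
    rw [Equiv.Perm.mul_apply, Equiv.Perm.mul_apply, hs.apply_shiftBy, h, shiftBy_inj] at e
    rw [e]
    exact Finset.mem_Icc.mpr (abs_le.mp hm)
  choose γ hγ hne using hex
  let x : Fin 2 → ℤ × ℕ := ![shiftBy b z, b]
  obtain ⟨y, hy⟩ := exists_mem_of_isLocal (Filter.map (fun N => ⇑(γ N) ∘ x) Filter.atTop)
  have htype : TypeEq R x y := fun S hS hx =>
    hy S (Filter.mem_map.mpr (Filter.univ_mem' fun N => hS.comp_mem (hγ N) hx)) (hS.isLocal hR)
  obtain ⟨g, hg, hgx⟩ := htype.exists_perm hR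
  have hy' := eq_shiftBy_of_snd_eq (hsame g hg b)
  rw [show g (shiftBy b z) = y 0 from hgx 0, show g b = y 1 from hgx 1] at hy'
  refine hy _ (Filter.mem_map.mpr ?_) (isLocal_eq_shiftBy 0 1 ((y 0).1 - (y 1).1)).compl hy'
  filter_upwards [Filter.Ici_mem_atTop ((y 0).1 - (y 1).1).natAbs] with N hN
  refine hne N _ ?_
  rw [Int.abs_eq_natAbs]
  exact_mod_cast hN

/-! ### Classes modulo `d` and signs -/

/-- The difference of `a` and `b` is an integer multiple of `d`. -/
def SameClass (d : ℤ) (a b : ℤ × ℕ) : Prop := ∃ n : ℤ, a = shiftBy b (n * d)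

/-- On the class of `a` modulo `d`, the permutation `γ` multiplies differences by `ε`. -/
def HasSign (d : ℤ) (γ : Equiv.Perm (ℤ × ℕ)) (a : ℤ × ℕ) (ε : ℤˣ) : Prop :=
  ∀ n : ℤ, γ (shiftBy a (n * d)) = shiftBy (γ a) (ε * (n * d))

section HasSign

variable {d : ℤ} {γ δ : Equiv.Perm (ℤ × ℕ)} {a b c : ℤ × ℕ} {ε ε' : ℤˣ}

theorem SameClass.symm (h : SameClass d a b) : SameClass d b a := by
  obtain ⟨n, rfl⟩ := h
  exact ⟨-n, by simp⟩

theorem SameClass.trans (h : SameClass d a b) (h' : SameClass d b c) : SameClass d a c := by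
  obtain ⟨n, rfl⟩ := h
  obtain ⟨m, rfl⟩ := h'
  exact ⟨m + n, by rw [shiftBy_shiftBy, add_mul]⟩

theorem SameClass.snd_eq (h : SameClass d a b) : a.2 = b.2 := by
  obtain ⟨n, rfl⟩ := h
  rfl

theorem sameClass_iff : SameClass d a b ↔ a.2 = b.2 ∧ d ∣ a.1 - b.1 := by
  constructor
  · rintro ⟨n, rfl⟩
    exact ⟨rfl, by simp [shiftBy]⟩
  · rintro ⟨h, n, hn⟩
    refine ⟨n, Prod.ext ?_ h⟩
    simp only [shiftBy]
    linarith

theorem HasSign.eq (hd : d ≠ 0) (h : HasSign d γ a ε) (h' : HasSign d γ a ε') : ε = ε' := by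
  have := (h 1).symm.trans (h' 1)
  rw [shiftBy_inj, one_mul, mul_left_inj' hd] at this
  exact Units.ext this

theorem HasSign.of_sameClass (h : HasSign d γ a ε) (hab : SameClass d b a) : HasSign d γ b ε := by
  obtain ⟨m, rfl⟩ := hab
  intro n
  rw [shiftBy_shiftBy, ← add_mul, h, h, shiftBy_shiftBy, add_mul, mul_add]

theorem HasSign.mul (h' : HasSign d δ (γ a) ε') (h : HasSign d γ a ε) :
    HasSign d (δ * γ) a (ε' * ε) := by
  intro n
  rw [Equiv.Perm.mul_apply, h, ← mul_assoc, h', Equiv.Perm.mul_apply, Units.val_mul]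
  congr 1
  ring

theorem IsShift.hasSign (h : IsShift γ) : HasSign d γ a 1 := fun n => by
  rw [h.apply_shiftBy, Units.val_one, one_mul]

theorem SameClass.map (h : HasSign d γ b ε) (hab : SameClass d a b) : SameClass d (γ a) (γ b) := by
  obtain ⟨n, rfl⟩ := hab
  exact ⟨ε * n, by rw [h, mul_assoc]⟩

theorem HasSign.sameClass_iff (h : HasSign d γ b ε) :
    SameClass d (γ a) (γ b) ↔ SameClass d a b := by
  refine ⟨fun ⟨n, hn⟩ => ⟨ε * n, ?_⟩, fun hab => hab.map h⟩
  rw [← γ.injective.eq_iff, hn, h, ← mul_assoc, ← mul_assoc, ← Units.val_mul, Int.units_mul_self,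
    Units.val_one, one_mul]

theorem exists_hasSign (hd : d ≠ 0)
    (h : ∀ a, γ (shiftBy a d) = shiftBy (γ a) d ∨ γ (shiftBy a d) = shiftBy (γ a) (-d)) (a : ℤ × ℕ) :
    ∃ ε, HasSign d γ a ε := by
  have h' : ∀ a, ∃ ε : ℤˣ, γ (shiftBy a d) = shiftBy (γ a) (ε * d) := fun a => by
    rcases h a with h | h
    · exact ⟨1, by simpa using h⟩
    · exact ⟨-1, by simpa using h⟩
  choose s hs using h'
  have hstep : ∀ a, s (shiftBy a d) = s a := fun a => by
    by_contra hne
    have h2 := hs (shiftBy a d)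
    rw [Int.units_ne_iff_eq_neg.mp hne, hs a, shiftBy_shiftBy, shiftBy_shiftBy, Units.val_neg,
      neg_mul, add_neg_cancel, shiftBy_zero, γ.injective.eq_iff, eq_comm, eq_shiftBy_self] at h2
    exact hd (by linarith)
  have hconst : ∀ n : ℤ, s (shiftBy a (n * d)) = s a := fun n => by
    induction n with
    | zero => simp
    | succ i ih => rw [add_mul, one_mul, ← shiftBy_shiftBy, hstep, ih]
    | pred i ih => rw [← ih, ← hstep, shiftBy_shiftBy, sub_mul, one_mul, sub_add_cancel]
  refine ⟨s a, fun n => ?_⟩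
  induction n with
  | zero => simp
  | succ i ih =>
    rw [add_mul, one_mul, ← shiftBy_shiftBy, hs, hconst, ih, shiftBy_shiftBy, mul_add]
  | pred i ih =>
    have := hs (shiftBy a ((-(i : ℤ) - 1) * d))
    rw [hconst, shiftBy_shiftBy, show (-(i : ℤ) - 1) * d + d = -i * d by ring, ih] at this
    rw [← shiftBy_left_inj (m := s a * d), ← this, shiftBy_shiftBy]
    congr 1
    ring

end HasSign

/-! ### Rearranging galaxies -/

/-- A group of permutations containing all shifts, acting by sign changes on the classes modulo `d`,
and moving different classes of a galaxy to different galaxies. -/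
structure IsClassGroup (d : ℤ) (Γ : Subgroup (Equiv.Perm (ℤ × ℕ))) : Prop where
  pos : 0 < d
  shift_mem : ∀ s, IsShift s → s ∈ Γ
  exists_hasSign : ∀ γ ∈ Γ, ∀ a, ∃ ε, HasSign d γ a ε
  exists_snd_ne : ∀ a b : ℤ × ℕ, a.2 = b.2 → ¬ SameClass d a b → ∃ γ ∈ Γ, (γ a).2 ≠ (γ b).2

/-- Some elements of the galaxies `h` and `h'` are sent to the same galaxy by `γ`. -/
def Linked (γ : Equiv.Perm (ℤ × ℕ)) (h h' : ℕ) : Prop :=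
  ∃ u v : ℤ × ℕ, u.2 = h ∧ v.2 = h' ∧ (γ u).2 = (γ v).2

/-- Any two entries of `t` in the same galaxy are in the same class modulo `d`. -/
def Separated (d : ℤ) {ι : Type} (t : ι → ℤ × ℕ) : Prop :=
  ∀ i j, (t i).2 = (t j).2 → SameClass d (t i) (t j)

theorem Linked.symm {γ : Equiv.Perm (ℤ × ℕ)} {h h' : ℕ} : Linked γ h h' → Linked γ h' h :=
  fun ⟨u, v, hu, hv, e⟩ => ⟨v, u, hv, hu, e.symm⟩

theorem linked_self (γ : Equiv.Perm (ℤ × ℕ)) (h : ℕ) : Linked γ h h :=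
  ⟨(0, h), (0, h), rfl, rfl, rfl⟩

theorem sameClass_emod (d : ℤ) (a : ℤ × ℕ) : SameClass d a (a.1 % d, a.2) :=
  sameClass_iff.mpr ⟨rfl, Int.dvd_self_sub_emod⟩

theorem exists_shift_rearranging {ι : Type} [Finite ι] (t : ι → ℤ × ℕ) {h : ℕ → ℕ}
    (hinj : Function.Injective h) (o : ℕ → ℤ) :
    ∃ s, IsShift s ∧ ∀ i, s (t i) = ((t i).1 + o (t i).2, h (t i).2) := by
  refine exists_isShift fun i j m => ?_
  simp only [shiftBy, Prod.ext_iff, hinj.eq_iff]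
  refine and_congr_left fun e => ?_
  rw [e]
  omega

namespace IsClassGroup

variable {d : ℤ} {Γ : Subgroup (Equiv.Perm (ℤ × ℕ))} (H : IsClassGroup d Γ)
  {δ : Equiv.Perm (ℤ × ℕ)} (hδ : δ ∈ Γ) {ι : Type} [Finite ι]
include H

theorem sameClass_map {γ : Equiv.Perm (ℤ × ℕ)} (hγ : γ ∈ Γ) {a b : ℤ × ℕ} (hab : SameClass d a b) :
    SameClass d (γ a) (γ b) := by
  obtain ⟨ε, hε⟩ := H.exists_hasSign γ hγ b
  exact hab.map hε

include hδ

theorem finite_linked (h : ℕ) : {h' | Linked δ h h'}.Finite := by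
  refine (((Set.finite_Ico 0 d).prod (Set.finite_Ico 0 d)).image
    fun r => (δ⁻¹ (r.2, (δ (r.1, h)).2)).2).subset ?_
  rintro _ ⟨u, v, rfl, rfl, e⟩
  have hmod : ∀ x : ℤ, x % d ∈ Set.Ico 0 d := fun x =>
    ⟨Int.emod_nonneg x H.pos.ne', Int.emod_lt_of_pos x H.pos⟩
  refine ⟨(u.1 % d, (δ v).1 % d), ⟨hmod _, hmod _⟩, ?_⟩
  dsimp only
  rw [← (H.sameClass_map hδ (sameClass_emod d u)).snd_eq, e,
    ← (H.sameClass_map (Γ.inv_mem hδ) (sameClass_emod d (δ v))).snd_eq]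
  simp

theorem exists_unlinked {X : Set ℕ} (hX : X.Infinite) (c g : ℕ) :
    ∃ h : ℕ → ℕ, h c = g ∧ (∀ j ≠ c, h j ∈ X) ∧ ∀ i j, Linked δ (h i) (h j) → i = j := by
  classical
  have : Std.Symm fun x y => ¬ Linked δ x y := ⟨fun x y h h' => h h'.symm⟩
  obtain ⟨f, hf, hf'⟩ := exists_seq_of_forall_finset_exists' (fun y => y ∈ X ∧ ¬ Linked δ g y)
    (fun x y => ¬ Linked δ x y) fun s _ => by
      obtain ⟨y, hy, hy'⟩ := hX.exists_notMem_finite ((H.finite_linked hδ g).union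
        (s.finite_toSet.biUnion fun x _ => H.finite_linked hδ x))
      simp only [Set.mem_union, Set.mem_iUnion, not_or, not_exists] at hy'
      exact ⟨y, ⟨hy, hy'.1⟩, fun x hx => hy'.2 x hx⟩
  refine ⟨Function.update f c g, by simp, fun j hj => by simpa [hj] using (hf j).1,
    fun i j hij => ?_⟩
  by_contra hne
  by_cases hi : i = c
  · subst hi
    rw [Function.update_self, Function.update_of_ne (Ne.symm hne)] at hij
    exact (hf j).2 hij
  by_cases hj : j = c
  · subst hj
    rw [Function.update_self, Function.update_of_ne hi] at hij
    exact (hf i).2 hij.symm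
  · rw [Function.update_of_ne hi, Function.update_of_ne hj] at hij
    exact hf' hne hij

omit hδ in
theorem exists_separated (v : ι → ℤ × ℕ) : ∃ γ ∈ Γ, Separated d (γ ∘ v) := by
  let P : Equiv.Perm (ℤ × ℕ) → Set (ι × ι) := fun γ => {p | (γ (v p.1)).2 = (γ (v p.2)).2}
  obtain ⟨γ, hγ, hmin⟩ := (measure fun γ => (P γ).ncard).wf.has_min (Γ : Set _) ⟨1, Γ.one_mem⟩
  refine ⟨γ, hγ, fun i j hij => ?_⟩
  by_contra hne
  obtain ⟨δ, hδ, hδne⟩ := H.exists_snd_ne _ _ hij hne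
  obtain ⟨h, hc, -, hunl⟩ := H.exists_unlinked hδ Set.infinite_univ (γ (v i)).2 (γ (v i)).2
  have hinj : Function.Injective h := fun i j e => hunl i j (e ▸ linked_self δ _)
  obtain ⟨s, hs, hst⟩ := exists_shift_rearranging (γ ∘ v) hinj 0
  simp only [Function.comp_apply, Pi.zero_apply, add_zero] at hst hij hδne
  refine hmin (δ * s * γ) (Γ.mul_mem (Γ.mul_mem hδ (H.shift_mem s hs)) hγ)
    (Set.ncard_lt_ncard ⟨fun p hp => ?_, fun hsub => ?_⟩ (Set.toFinite _))
  · exact hunl _ _ ⟨s (γ (v p.1)), s (γ (v p.2)), by rw [hst], by rw [hst], hp⟩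
  · refine hδne ?_
    have hi : s (γ (v i)) = γ (v i) := by rw [hst, hc]
    have hj : s (γ (v j)) = γ (v j) := by rw [hst, ← hij, hc, hij]
    have := hsub (show (i, j) ∈ P γ from hij)
    simpa [P, hi, hj] using this

theorem exists_flip {a : ℤ × ℕ} {ε₀ ε₁ : ℤˣ} (ha : HasSign d δ a ε₀)
    (hX : {h | ∃ b : ℤ × ℕ, b.2 = h ∧ HasSign d δ b ε₁}.Infinite) {t : ι → ℤ × ℕ}
    (ht : Separated d t) (c : ℕ) :
    ∃ γ ∈ Γ, Separated d (γ ∘ t) ∧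
      ∀ j, HasSign d γ (t j) (if (t j).2 = c then ε₀ else ε₁) := by
  obtain ⟨h, hc, hmem, hunl⟩ := H.exists_unlinked hδ hX c a.2
  have hinj : Function.Injective h := fun i j e => hunl i j (e ▸ linked_self δ _)
  have hq : ∀ c', ∃ q : ℤ × ℕ, q.2 = h c' ∧ HasSign d δ q (if c' = c then ε₀ else ε₁) := by
    intro c'
    split_ifs with e
    · exact ⟨a, by rw [e, hc], ha⟩
    · exact hmem c' e
  choose q hq hqs using hq
  have hbase : ∀ c', ∃ x : ℤ, ∀ j, (t j).2 = c' → d ∣ (t j).1 - x := by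
    intro c'
    by_cases hex : ∃ i, (t i).2 = c'
    · obtain ⟨i, rfl⟩ := hex
      exact ⟨(t i).1, fun j hj => (_root_.sameClass_iff.mp (ht j i hj)).2⟩
    · exact ⟨0, fun j hj => (hex ⟨j, hj⟩).elim⟩
  choose x hx using hbase
  obtain ⟨s, hs, hst⟩ := exists_shift_rearranging t hinj fun c' => (q c').1 - x c'
  have hγ : δ * s ∈ Γ := Γ.mul_mem hδ (H.shift_mem s hs)
  refine ⟨δ * s, hγ, fun i j hij => ?_, fun j => ?_⟩
  · refine H.sameClass_map hγ (ht i j (hunl _ _ ⟨s (t i), s (t j), ?_, ?_, hij⟩)) <;> rw [hst]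
  · have hsq : SameClass d (s (t j)) (q (t j).2) := by
      rw [hst, _root_.sameClass_iff]
      refine ⟨(hq _).symm, ?_⟩
      convert hx _ j rfl using 1
      ring
    simpa using ((hqs (t j).2).of_sameClass hsq).mul (hs.hasSign (a := t j))

theorem exists_flip_one {a b : ℤ × ℕ} (ha : HasSign d δ a (-1)) (hb : HasSign d δ b 1)
    {t : ι → ℤ × ℕ} (ht : Separated d t) (c : ℕ) :
    ∃ γ ∈ Γ, Separated d (γ ∘ t) ∧ ∀ j, HasSign d γ (t j) (if (t j).2 = c then -1 else 1) := by
  by_cases hX : {h | ∃ b : ℤ × ℕ, b.2 = h ∧ HasSign d δ b 1}.Infinite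
  · exact H.exists_flip hδ ha hX ht c
  have hX' : {h | ∃ b : ℤ × ℕ, b.2 = h ∧ HasSign d δ b (-1)}.Infinite := by
    refine (Set.Finite.infinite_compl (Set.not_infinite.mp hX)).mono fun h hh => ?_
    obtain ⟨ε, hε⟩ := H.exists_hasSign δ hδ (0, h)
    rcases Int.units_eq_one_or ε with rfl | rfl
    · exact (hh ⟨_, rfl, hε⟩).elim
    · exact ⟨_, rfl, hε⟩
  obtain ⟨γ, hγ, hsep, hs⟩ := H.exists_flip hδ hb hX' ht c
  obtain ⟨γ', hγ', hsep', hs'⟩ := H.exists_flip hδ ha hX' hsep c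
  refine ⟨γ' * γ, Γ.mul_mem hγ' hγ, hsep', fun j => ?_⟩
  have := (hs' j).mul (hs j)
  rw [ite_self] at this
  convert this using 1
  split_ifs <;> simp

theorem exists_pattern {a b : ℤ × ℕ} (ha : HasSign d δ a (-1)) (hb : HasSign d δ b 1)
    {t : ι → ℤ × ℕ} (ht : Separated d t) (η : ι → ℤˣ)
    (hη : ∀ i j, SameClass d (t i) (t j) → η i = η j) :
    ∃ γ ∈ Γ, Separated d (γ ∘ t) ∧ ∀ j, HasSign d γ (t j) (η j) := by
  induction hN : {j | η j = -1}.ncard using Nat.strong_induction_on generalizing t η with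
  | _ N ih =>
    by_cases hne : ∃ i, η i = -1
    · obtain ⟨i, hi⟩ := hne
      obtain ⟨γ, hγ, hsep, hs⟩ := H.exists_flip_one hδ ha hb ht (t i).2
      have hflip : ∀ j, (t j).2 = (t i).2 → η j = -1 := fun j hj => by
        rw [hη j i (ht j i hj), hi]
      let η' : ι → ℤˣ := fun j => η j * if (t j).2 = (t i).2 then -1 else 1
      obtain ⟨γ', hγ', hsep', hs'⟩ := ih {j | η' j = -1}.ncard (by
        rw [← hN]
        refine Set.ncard_lt_ncard ⟨fun j hj => ?_, fun hsub => ?_⟩ (Set.toFinite _)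
        · by_cases h : (t j).2 = (t i).2
          · exact hflip j h
          · simpa [η', h] using hj
        · have := hsub (show i ∈ {j | η j = -1} from hi)
          simp [η', hi] at this) hsep η' (fun j k hjk => by
        have hjk' : SameClass d (t j) (t k) := (hs k).sameClass_iff.mp hjk
        simp only [η', hη j k hjk', hjk'.snd_eq]) rfl
      refine ⟨γ' * γ, Γ.mul_mem hγ' hγ, hsep', fun j => ?_⟩
      have := (hs' j).mul (hs j)
      simpa only [η', mul_assoc, Int.units_mul_self, mul_one] using this
    · refine ⟨1, Γ.one_mem, ht, fun j => ?_⟩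
      rw [(Int.units_eq_one_or (η j)).resolve_right fun h => hne ⟨j, h⟩]
      exact fun n => by simp

end IsClassGroup

/-! ### Relations determined by signs -/

theorem isClassGroup_gammaSubgroup {n : ℕ} {R : (Fin n → ℤ × ℕ) → Prop} (hR : IsLocal {v | R v})
    {d : ℤ} (hd : 0 < d) (hdvd : ∀ z : ℤ, Regular (GammaR R) z → d ∣ z)
    (hgreatest : ∀ e : ℤ, (∀ z : ℤ, Regular (GammaR R) z → e ∣ z) → e ∣ d) :
    IsClassGroup d (gammaSubgroup R) where
  pos := hd
  shift_mem _ hs := hs.preserves hR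
  exists_hasSign _ hγ := exists_hasSign hd.ne' (apply_shiftBy_eq_or (fun _ hs => hs.preserves hR)
    hd.ne' (fun _ => regular_iff_dvd (Γ := gammaSubgroup R) hdvd hgreatest) hγ)
  exists_snd_ne a b hab hne := by
    rw [sameClass_iff, ← regular_iff_dvd (Γ := gammaSubgroup R) hdvd hgreatest] at hne
    rw [eq_shiftBy_of_snd_eq hab]
    exact exists_snd_ne_of_not_regular hR (fun h => hne ⟨hab, h⟩) b

theorem iff_of_hasSign {n : ℕ} {R : (Fin n → ℤ × ℕ) → Prop} (hR : IsLocal {v | R v}) {d : ℤ}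
    {φ ψ : Equiv.Perm (ℤ × ℕ)} {v : Fin n → ℤ × ℕ} {σ : Fin n → ℤˣ}
    (hφ : ∀ j, HasSign d φ (v j) (σ j)) (hψ : ∀ j, HasSign d ψ (v j) (σ j))
    (hφv : Separated d (φ ∘ v)) (hψv : Separated d (ψ ∘ v)) : R (φ ∘ v) ↔ R (ψ ∘ v) := by
  obtain ⟨N, hN⟩ := hR
  refine hN _ _ fun i j m _ => ?_
  by_cases h : SameClass d (v i) (v j)
  · obtain ⟨k, hk⟩ := h
    simp only [Function.comp_apply, hk, hφ j k, hψ j k, shiftBy_inj]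
  · have hne : ∀ {χ : Equiv.Perm (ℤ × ℕ)}, (∀ j, HasSign d χ (v j) (σ j)) → Separated d (χ ∘ v) →
        χ (v i) ≠ shiftBy (χ (v j)) m := fun hχ hχv e =>
      h ((hχ j).sameClass_iff.mp (hχv i j (by simp [e])))
    exact iff_of_false (hne hφ hφv) (hne hψ hψv)

/-- A permutation acting by sign changes on the classes modulo `d` preserves `R` as soon as the
relevant patterns of signs are realized by elements of the group of `R`. -/
theorem preserves_of_patterns {n : ℕ} {R : (Fin n → ℤ × ℕ) → Prop} (hR : IsLocal {v | R v}) {d : ℤ}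
    (H : IsClassGroup d (gammaSubgroup R)) {g : Equiv.Perm (ℤ × ℕ)} {ε : ℤ × ℕ → ℤˣ}
    (hg : ∀ a, HasSign d g a (ε a)) (P : Set (Fin n → ℤˣ))
    (hP : ∀ γ ∈ GammaR R, ∀ γ' ∈ GammaR R, ∀ (v : Fin n → ℤ × ℕ) (α β : Fin n → ℤˣ),
      (∀ j, HasSign d γ (v j) (α j)) → (∀ j, HasSign d γ' (g (v j)) (β j)) →
        (fun j => β j * ε (v j) * α j) ∈ P)
    (hreal : ∀ t : Fin n → ℤ × ℕ, Separated d t → ∀ η ∈ P,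
      (∀ i j, SameClass d (t i) (t j) → η i = η j) →
        ∃ γ ∈ GammaR R, Separated d (γ ∘ t) ∧ ∀ j, HasSign d γ (t j) (η j)) :
    Preserves g R := by
  intro v
  obtain ⟨γ, hγ, hsep⟩ := H.exists_separated v
  obtain ⟨γ', hγ', hsep'⟩ := H.exists_separated (g ∘ v)
  choose α hα using H.exists_hasSign γ hγ
  choose β hβ using H.exists_hasSign γ' hγ'
  obtain ⟨δ, hδ, hsepδ, hs⟩ := hreal (γ ∘ v) hsep _
    (hP γ hγ γ' hγ' v _ _ (fun j => hα (v j)) fun j => hβ (g (v j))) fun i j hij => by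
      have h : SameClass d (v i) (v j) := (hα (v j)).sameClass_iff.mp hij
      rw [HasSign.eq H.pos.ne' (hα (v i)) ((hα (v j)).of_sameClass h),
        HasSign.eq H.pos.ne' (hg (v i)) ((hg (v j)).of_sameClass h),
        HasSign.eq H.pos.ne' (hβ (g (v i))) ((hβ (g (v j))).of_sameClass (h.map (hg (v j))))]
  have key := iff_of_hasSign (φ := γ' * g) (ψ := δ * γ) hR
    (fun j => (hβ (g (v j))).mul (hg (v j))) (fun j => by
      have := (hs j).mul (hα (v j))
      rwa [mul_assoc, Int.units_mul_self, mul_one] at this) hsep' hsepδ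
  exact ((hγ' (g ∘ v)).symm.trans key).trans ((hδ (γ ∘ v)).trans (hγ v))

section Types

variable {d : ℤ} {g : Equiv.Perm (ℤ × ℕ)}

theorem hasSign_of_diff_eq {a : ℤ × ℕ} {ε : ℤˣ} {N : ℕ} (hd : d ≠ 0) (hN : 0 < N)
    (h : ∃ ε', HasSign d g a ε')
    (hg : diff (g (shiftBy a (N * d))) (g a) = ((ε * (N * d) : ℤ) : WithTop ℤ)) :
    HasSign d g a ε := by
  obtain ⟨ε', hε'⟩ := h
  have hNd : (N : ℤ) * d ≠ 0 := mul_ne_zero (by exact_mod_cast hN.ne') hd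
  rw [diff_eq_coe, hε' N, shiftBy_inj, mul_left_inj' hNd] at hg
  rwa [← Units.ext hg]

theorem HasSign.diff_eq {a : ℤ × ℕ} {ε : ℤˣ} (h : HasSign d g a ε) (N : ℕ) :
    diff (g (shiftBy a (N * d))) (g a) = ((ε * (N * d) : ℤ) : WithTop ℤ) := by
  rw [diff_eq_coe, h]

theorem thirdType_of_hasSign {a b : ℤ × ℕ} (h : ∀ a, ∃ ε, HasSign d g a ε)
    (ha : HasSign d g a 1) (hb : HasSign d g b (-1)) : ThirdType d g := by
  refine ⟨fun c N => ?_, ⟨a, 1, one_pos, ?_⟩, ⟨b, 1, one_pos, ?_⟩⟩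
  · obtain ⟨ε, hε⟩ := h c
    rw [hε.diff_eq N]
    rcases Int.units_eq_one_or ε with rfl | rfl <;> simp
  · rw [ha.diff_eq 1]
    simp
  · rw [hb.diff_eq 1]
    simp

end Types

theorem isLocal_arel (d : ℤ) : IsLocal {v | Arel d v} := by
  simp only [Arel, diff_eq_coe]
  exact isLocal_eq_shiftBy 0 1 d

theorem isLocal_brel (d : ℤ) : IsLocal {v | Brel d v} := by
  simp only [Brel, diff_eq_coe]
  exact ((isLocal_eq_shiftBy 0 1 d).inter (isLocal_eq_shiftBy 2 3 d)).union
    ((isLocal_eq_shiftBy 0 1 (-d)).inter (isLocal_eq_shiftBy 2 3 (-d)))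

theorem crel_iff {d : ℤ} (hd : 0 ≤ d) (v : Fin 2 → ℤ × ℕ) :
    Crel d v ↔ v 0 = shiftBy (v 1) d ∨ v 0 = shiftBy (v 1) (-d) := by
  rw [← diff_eq_coe, ← diff_eq_coe, Crel, wabs]
  cases diff (v 0) (v 1) with
  | top => simp only [WithTop.map_top, WithTop.top_ne_coe, or_self]
  | coe m => simp only [WithTop.map_coe, WithTop.coe_inj, abs_eq hd]

theorem isLocal_crel {d : ℤ} (hd : 0 ≤ d) : IsLocal {v | Crel d v} := by
  simp only [crel_iff hd]
  exact (isLocal_eq_shiftBy 0 1 d).union (isLocal_eq_shiftBy 0 1 (-d))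

theorem HasSign.eq_shiftBy_iff {d : ℤ} {g : Equiv.Perm (ℤ × ℕ)} {a b : ℤ × ℕ} {ε : ℤˣ}
    (h : HasSign d g b ε) (n : ℤ) :
    g a = shiftBy (g b) (ε * (n * d)) ↔ a = shiftBy b (n * d) := by
  rw [← h, g.injective.eq_iff]

theorem HasSign.eq_shiftBy_or_iff {d : ℤ} {g : Equiv.Perm (ℤ × ℕ)} {a b : ℤ × ℕ} {ε : ℤˣ}
    (h : HasSign d g b ε) :
    (g a = shiftBy (g b) d ∨ g a = shiftBy (g b) (-d)) ↔ (a = shiftBy b d ∨ a = shiftBy b (-d)) := by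
  have h₁ := h.eq_shiftBy_iff (a := a) 1
  have h₂ := h.eq_shiftBy_iff (a := a) (-1)
  rcases Int.units_eq_one_or ε with rfl | rfl
  · simp_all
  · simp_all [or_comm]

theorem exists_hasSign_of_mem_gammaR_crel {d : ℤ} (hd : 0 < d) {g : Equiv.Perm (ℤ × ℕ)}
    (hg : g ∈ GammaR (Crel d)) (a : ℤ × ℕ) : ∃ ε, HasSign d g a ε := by
  refine exists_hasSign hd.ne' (fun a => ?_) a
  have := (hg ![shiftBy a d, a]).mpr ((crel_iff hd.le _).mpr (Or.inl rfl))
  rwa [crel_iff hd.le] at this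

theorem hasSign_of_mem_gammaR_arel {d : ℤ} (hd : 0 < d) {g : Equiv.Perm (ℤ × ℕ)}
    (hg : g ∈ GammaR (Arel d)) (a : ℤ × ℕ) : HasSign d g a 1 := by
  have h : ∀ a, g (shiftBy a d) = shiftBy (g a) d := fun a =>
    diff_eq_coe.mp ((hg ![shiftBy a d, a]).mpr (diff_eq_coe.mpr rfl))
  refine hasSign_of_diff_eq hd.ne' one_pos (exists_hasSign hd.ne' (fun a => Or.inl (h a)) a) ?_
  simpa [diff_eq_coe] using h a

theorem exists_forall_hasSign_of_mem_gammaR_brel {d : ℤ} (hd : 0 < d) {g : Equiv.Perm (ℤ × ℕ)}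
    (hg : g ∈ GammaR (Brel d)) : ∃ ε, ∀ a, HasSign d g a ε := by
  have h : ∀ a b, (g (shiftBy a d) = shiftBy (g a) d ∧ g (shiftBy b d) = shiftBy (g b) d) ∨
      (g (shiftBy a d) = shiftBy (g a) (-d) ∧ g (shiftBy b d) = shiftBy (g b) (-d)) := fun a b => by
    have := (hg ![shiftBy a d, a, shiftBy b d, b]).mpr
      (Or.inl ⟨diff_eq_coe.mpr rfl, diff_eq_coe.mpr rfl⟩)
    simp only [Brel, diff_eq_coe] at this
    exact this
  have hex : ∀ a, ∃ ε, HasSign d g a ε :=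
    exists_hasSign hd.ne' fun a => (h a a).imp And.left And.left
  rcases h (0, 0) (0, 0) with ⟨h₀, -⟩ | ⟨h₀, -⟩
  · refine ⟨1, fun a => hasSign_of_diff_eq hd.ne' one_pos (hex a) ?_⟩
    rcases h (0, 0) a with ⟨-, h'⟩ | ⟨h', -⟩
    · simpa [diff_eq_coe] using h'
    · rw [h₀, shiftBy_inj] at h'
      omega
  · refine ⟨-1, fun a => hasSign_of_diff_eq hd.ne' one_pos (hex a) ?_⟩
    rcases h (0, 0) a with ⟨h', -⟩ | ⟨-, h'⟩
    · rw [h₀, shiftBy_inj] at h'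
      omega
    · rw [diff_eq_coe]
      simpa using h'

theorem preserves_arel {d : ℤ} {g : Equiv.Perm (ℤ × ℕ)} (hg : ∀ a, HasSign d g a 1) :
    Preserves g (Arel d) := fun v => by
  simpa [Arel, diff_eq_coe] using (hg (v 1)).eq_shiftBy_iff (a := v 0) 1

theorem preserves_brel {d : ℤ} {g : Equiv.Perm (ℤ × ℕ)} {ε : ℤˣ} (hg : ∀ a, HasSign d g a ε) :
    Preserves g (Brel d) := fun v => by
  have h₁ := fun i j => (hg (v j)).eq_shiftBy_iff (a := v i) 1
  have h₂ := fun i j => (hg (v j)).eq_shiftBy_iff (a := v i) (-1)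
  simp only [Brel, diff_eq_coe, Function.comp_apply]
  rcases Int.units_eq_one_or ε with rfl | rfl
  · simp_all
  · simp_all [or_comm]

theorem preserves_crel {d : ℤ} (hd : 0 < d) {g : Equiv.Perm (ℤ × ℕ)}
    (hg : ∀ a, ∃ ε, HasSign d g a ε) : Preserves g (Crel d) := fun v => by
  obtain ⟨ε, hε⟩ := hg (v 1)
  rw [crel_iff hd.le, crel_iff hd.le]
  exact hε.eq_shiftBy_or_iff

/-- Suppose `R` is definable in `M_Z`, some nonzero integer is regular with respect to
`Γ_R`, and `d` is the greatest common divisor of the regular integers.  Then: (i) if every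
permutation in `Γ_R` is of the first type then `R ≈ A_d`; (ii) if `Γ_R` contains a
permutation of the second type but none of the third type then `R ≈ B_d`; (iii) if `Γ_R`
contains a permutation of the third type then `R ≈ C_d`. -/
theorem classification_MZ {n : ℕ} (R : (Fin n → ℤ × ℕ) → Prop)
    (hR : DefinableBy succRel R)
    (hex : ∃ z : ℤ, z ≠ 0 ∧ Regular (GammaR R) z)
    (d : ℤ) (hd0 : 0 ≤ d)
    (hdvd : ∀ z : ℤ, Regular (GammaR R) z → d ∣ z)
    (hgreatest : ∀ e : ℤ, (∀ z : ℤ, Regular (GammaR R) z → e ∣ z) → e ∣ d) :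
    ((∀ f ∈ GammaR R, FirstType d f) → DefEquiv R (Arel d)) ∧
    ((∃ f ∈ GammaR R, SecondType d f) → (∀ f ∈ GammaR R, ¬ ThirdType d f) →
      DefEquiv R (Brel d)) ∧
    ((∃ f ∈ GammaR R, ThirdType d f) → DefEquiv R (Crel d)) := by
  have hRloc : IsLocal {v | R v} := (definableBy_iff.mp hR).isLocal isLocal_succRel
  have hd : 0 < d := by
    obtain ⟨z, hz, hreg⟩ := hex
    refine hd0.lt_of_ne fun e => hz (zero_dvd_iff.mp ?_)
    rw [e]
    exact hdvd z hreg
  have H : IsClassGroup d (gammaSubgroup R) := isClassGroup_gammaSubgroup hRloc hd hdvd hgreatest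
  have hsign : ∀ g ∈ GammaR R, ∀ a, ∃ ε, HasSign d g a ε := H.exists_hasSign
  refine ⟨fun hfirst => ?_, fun ⟨f, hf, hsecond⟩ hthird => ?_, fun ⟨f, hf, hthird⟩ => ?_⟩
  · have hone : ∀ g ∈ GammaR R, ∀ a, HasSign d g a 1 := fun g hg a =>
      hasSign_of_diff_eq hd.ne' one_pos (hsign g hg a) (by simpa using hfirst g hg a 1)
    refine ⟨definableBy_of_preserves hRloc (isLocal_arel d) fun g hg => preserves_arel (hone g hg),
      definableBy_of_preserves (isLocal_arel d) hRloc fun g hg => ?_⟩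
    refine preserves_of_patterns hRloc H (hasSign_of_mem_gammaR_arel hd hg) {1} ?_ ?_
    · intro γ hγ γ' hγ' v α β hα hβ
      funext j
      simp [(hα j).eq hd.ne' (hone γ hγ _), (hβ j).eq hd.ne' (hone γ' hγ' _)]
    · rintro t ht _ rfl -
      exact ⟨1, (gammaSubgroup R).one_mem, ht, fun j n => by simp⟩
  · have hconst : ∀ g ∈ GammaR R, ∃ ε, ∀ a, HasSign d g a ε := fun g hg => by
      by_contra! hne
      obtain ⟨a, ha⟩ := hne 1
      obtain ⟨b, hb⟩ := hne (-1)
      obtain ⟨ε, hε⟩ := hsign g hg a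
      obtain ⟨ε', hε'⟩ := hsign g hg b
      rcases Int.units_eq_one_or ε with rfl | rfl
      · exact ha hε
      rcases Int.units_eq_one_or ε' with rfl | rfl
      · exact hthird g hg (thirdType_of_hasSign (hsign g hg) hε' hε)
      · exact hb hε'
    have hneg : ∀ a, HasSign d f a (-1) := fun a =>
      hasSign_of_diff_eq hd.ne' one_pos (hsign f hf a) (by simpa using hsecond a 1)
    refine ⟨definableBy_of_preserves hRloc (isLocal_brel d) fun g hg => ?_,
      definableBy_of_preserves (isLocal_brel d) hRloc fun g hg => ?_⟩
    · obtain ⟨ε, hε⟩ := hconst g hg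
      exact preserves_brel hε
    obtain ⟨ε, hε⟩ := exists_forall_hasSign_of_mem_gammaR_brel hd hg
    refine preserves_of_patterns hRloc H hε (Set.range fun ε _ => ε) ?_ ?_
    · intro γ hγ γ' hγ' v α β hα hβ
      obtain ⟨ε₁, h₁⟩ := hconst γ hγ
      obtain ⟨ε₂, h₂⟩ := hconst γ' hγ'
      refine ⟨ε₂ * ε * ε₁, funext fun j => ?_⟩
      simp only [(hα j).eq hd.ne' (h₁ _), (hβ j).eq hd.ne' (h₂ _)]
    · rintro t ht _ ⟨η, rfl⟩ -
      rcases Int.units_eq_one_or η with rfl | rfl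
      · exact ⟨1, (gammaSubgroup R).one_mem, ht, fun j n => by simp⟩
      · have hX : {h | ∃ b : ℤ × ℕ, b.2 = h ∧ HasSign d f b (-1)} = Set.univ :=
          Set.eq_univ_of_forall fun h => ⟨(0, h), rfl, hneg _⟩
        obtain ⟨γ, hγ, hsep, hs⟩ :=
          H.exists_flip hf (hneg (0, 0)) (hX ▸ Set.infinite_univ) ht 0
        exact ⟨γ, hγ, hsep, fun j => by simpa only [ite_self] using hs j⟩
  · obtain ⟨-, ⟨a, N, hN, ha⟩, ⟨b, N', hN', hb⟩⟩ := hthird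
    have ha' : HasSign d f a 1 :=
      hasSign_of_diff_eq hd.ne' hN (hsign f hf a) (by simpa using ha)
    have hb' : HasSign d f b (-1) :=
      hasSign_of_diff_eq hd.ne' hN' (hsign f hf b) (by simpa using hb)
    refine ⟨definableBy_of_preserves hRloc (isLocal_crel hd0) fun g hg =>
        preserves_crel hd (hsign g hg),
      definableBy_of_preserves (isLocal_crel hd0) hRloc fun g hg => ?_⟩
    choose ε hε using exists_hasSign_of_mem_gammaR_crel hd hg
    exact preserves_of_patterns hRloc H hε Set.univ (fun _ _ _ _ _ _ _ _ _ => trivial)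
      fun t ht η _ hη => H.exists_pattern hf hb' ha' ht η hη
end

section
/- For every natural number n ≥ 1 one has A_n ≻ B_n ≻ C_n: A_n ≽ B_n but not B_n ≽ A_n, and B_n ≽ C_n but not C_n ≽ B_n. -/
open FirstOrder Language

/-- The successor relation on `ℤ` : `v 1 = v 0 + 1`. -/
def succZ : (Fin 2 → ℤ) → Prop := fun v => v 1 = v 0 + 1

/-- The binary relation `A_n` : `x₁ − x₂ = n` on `ℤ`. -/
def AZ (n : ℕ) : (Fin 2 → ℤ) → Prop := fun v => v 0 - v 1 = (n : ℤ)

/-- The 4-ary relation `B_n` :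
`(x₁ − x₂ = n ∧ x₃ − x₄ = n) ∨ (x₁ − x₂ = −n ∧ x₃ − x₄ = −n)` on `ℤ`. -/
def BZ (n : ℕ) : (Fin 4 → ℤ) → Prop := fun v =>
  (v 0 - v 1 = (n : ℤ) ∧ v 2 - v 3 = (n : ℤ)) ∨
  (v 0 - v 1 = -(n : ℤ) ∧ v 2 - v 3 = -(n : ℤ))

/-- The binary relation `C_n` : `|x₁ − x₂| = n` on `ℤ`. -/
def CZ (n : ℕ) : (Fin 2 → ℤ) → Prop := fun v => |v 0 - v 1| = (n : ℤ)

section Definability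

variable {M : Type*} {n k : ℕ} {Q : (Fin n → M) → Prop} {R S : (Fin k → M) → Prop}

theorem definableBy_comp (Q : (Fin n → M) → Prop) (f : Fin n → Fin k) :
    DefinableBy Q (fun v : Fin k → M => Q (fun i => v (f i))) := by
  let _ : (relLang n).Structure M := multiRelStructure (fun _ : Unit => Q)
  let r : (relLang n).Relations n := ⟨(), rfl⟩
  exact ⟨r.formula fun i => Term.var (f i), fun v =>
    (Formula.realize_rel (R := r) (ts := fun i => Term.var (f i)) (v := v)).symm⟩

theorem DefinableBy.and (hR : DefinableBy Q R) (hS : DefinableBy Q S) :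
    DefinableBy Q (fun v => R v ∧ S v) := by
  let _ : (relLang n).Structure M := multiRelStructure (fun _ : Unit => Q)
  obtain ⟨φ, hφ⟩ := hR
  obtain ⟨ψ, hψ⟩ := hS
  exact ⟨φ ⊓ ψ, fun v => (and_congr (hφ v) (hψ v)).trans Formula.realize_inf.symm⟩

theorem DefinableBy.or (hR : DefinableBy Q R) (hS : DefinableBy Q S) :
    DefinableBy Q (fun v => R v ∨ S v) := by
  let _ : (relLang n).Structure M := multiRelStructure (fun _ : Unit => Q)
  obtain ⟨φ, hφ⟩ := hR
  obtain ⟨ψ, hψ⟩ := hS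
  exact ⟨φ ⊔ ψ, fun v => (or_congr (hφ v) (hψ v)).trans Formula.realize_sup.symm⟩

/-- An involution of an ultrapower which preserves (the extension of) a relation `Q` preserves
every relation definable from `Q`. -/
theorem DefinableBy.eventually_involution_iff [Nonempty M] (h : DefinableBy Q R) {α : Type*}
    (u : Ultrafilter α) (τ : (α → M) → α → M)
    (hcongr : ∀ f g : α → M, (∀ᶠ a in u, f a = g a) → ∀ᶠ a in u, τ f a = τ g a)
    (hinv : ∀ f : α → M, ∀ᶠ a in u, τ (τ f) a = f a)
    (hQ : ∀ v : Fin n → α → M,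
      (∀ᶠ a in u, Q fun i => τ (v i) a) ↔ ∀ᶠ a in u, Q fun i => v i a)
    (v : Fin k → α → M) :
    (∀ᶠ a in u, R fun i => τ (v i) a) ↔ ∀ᶠ a in u, R fun i => v i a := by
  let _ : (relLang n).Structure M := multiRelStructure (fun _ : Unit => Q)
  obtain ⟨φ, hφ⟩ := h
  let N := (u : Filter α).Product fun _ => M
  let mk : (α → M) → N := Quotient.mk ((u : Filter α).productSetoid fun _ => M)
  let σ : N → N := Quotient.map τ hcongr
  have hσ : Function.Involutive σ := by
    rintro ⟨f⟩
    exact Quotient.sound (hinv f)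
  have hrel {m : ℕ} (r : (relLang n).Relations m) (w : Fin m → α → M) :
      Structure.RelMap r (fun i => mk (w i)) ↔
        ∀ᶠ a in u, Structure.RelMap r fun i => w i a :=
    (relMap_quotient_mk' (s := (u : Filter α).productSetoid fun _ => M) r w)
  let e : N ≃[relLang n] N :=
    { hσ.toPerm with
      map_fun' := fun f => f.elim
      map_rel' := by
        intro m r x
        obtain ⟨⟨⟩, rfl⟩ := r
        obtain ⟨w, rfl⟩ : ∃ w : Fin n → α → M, (fun i => mk (w i)) = x :=
          ⟨fun i => (x i).out, funext fun i => Quotient.out_eq (x i)⟩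
        exact (hrel _ fun i => τ (w i)).trans ((hQ w).trans (hrel _ w).symm) }
  have key := StrongHomClass.realize_formula e φ (v := fun i => mk (v i))
  have h₁ := Ultraproduct.realize_formula_cast (u := u) φ v
  have h₂ := Ultraproduct.realize_formula_cast (u := u) φ fun i => τ (v i)
  simp only [hφ]
  exact h₂.symm.trans (key.trans h₁)

end Definability

theorem definableBy_AZ_BZ (n : ℕ) : DefinableBy (AZ n) (BZ n) := by
  have h : BZ n = fun v =>
      (AZ n (fun i => v (![0, 1] i)) ∧ AZ n (fun i => v (![2, 3] i))) ∨
      (AZ n (fun i => v (![1, 0] i)) ∧ AZ n (fun i => v (![3, 2] i))) := by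
    funext v
    simp only [AZ, BZ, Matrix.cons_val_zero, Matrix.cons_val_one, eq_iff_iff]
    lia
  rw [h]
  exact ((definableBy_comp _ _).and (definableBy_comp _ _)).or
    ((definableBy_comp _ _).and (definableBy_comp _ _))

theorem definableBy_BZ_CZ (n : ℕ) : DefinableBy (BZ n) (CZ n) := by
  have h : CZ n = fun v => BZ n (fun i => v (![0, 1, 0, 1] i)) := by
    funext v
    simp [BZ, CZ, abs_eq (Int.natCast_nonneg n)]
  rw [h]
  exact definableBy_comp _ _

theorem not_definableBy_BZ_AZ {n : ℕ} (hn : 1 ≤ n) : ¬ DefinableBy (BZ n) (AZ n) := by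
  intro h
  have key := h.eventually_involution_iff (pure ()) (fun f a => -f a)
    (fun f g hfg => hfg.mono fun a ha => congrArg Neg.neg ha)
    (fun f => .of_forall fun a => neg_neg (f a))
    (fun v => Filter.eventually_congr (.of_forall fun a => by simp only [BZ]; lia))
    ![fun _ => (n : ℤ), fun _ => 0]
  simp [AZ] at key
  lia

/-- A function is eventually constant along an ultrafilter if it stays at bounded distance
from one that is. -/
theorem eventually_const_of_abs_sub_eq {α : Type*} {u : Ultrafilter α} {f g : α → ℤ} {d : ℤ}
    (h : ∀ᶠ a in u, |f a - g a| = d) (hf : ∃ c, ∀ᶠ a in u, f a = c) :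
    ∃ c, ∀ᶠ a in u, g a = c := by
  obtain ⟨c, hc⟩ := hf
  have : ∀ᶠ a in u, g a = c - d ∨ g a = c + d := by
    filter_upwards [h, hc] with a h₁ h₂
    rcases abs_choice (f a - g a) with h₃ | h₃ <;> lia
  rcases Ultrafilter.eventually_or.1 this with h' | h'
  exacts [⟨_, h'⟩, ⟨_, h'⟩]

open scoped Classical in
/-- Negation away from the eventually constant functions. -/
noncomputable def negNonconst {α : Type*} (u : Ultrafilter α) (f : α → ℤ) : α → ℤ :=
  if ∃ c, ∀ᶠ a in u, f a = c then f else -f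

section NegNonconst

variable {α : Type*} {u : Ultrafilter α} {f g : α → ℤ} {d : ℤ}

theorem negNonconst_of_const (hf : ∃ c, ∀ᶠ a in u, f a = c) : negNonconst u f = f :=
  if_pos hf

theorem negNonconst_of_not_const (hf : ¬ ∃ c, ∀ᶠ a in u, f a = c) : negNonconst u f = -f :=
  if_neg hf

theorem negNonconst_congr (h : ∀ᶠ a in u, f a = g a) :
    ∀ᶠ a in u, negNonconst u f a = negNonconst u g a := by
  have hiff : (∃ c, ∀ᶠ a in u, f a = c) ↔ ∃ c, ∀ᶠ a in u, g a = c :=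
    exists_congr fun c => Filter.eventually_congr (h.mono fun a ha => by rw [ha])
  by_cases hf : ∃ c, ∀ᶠ a in u, f a = c
  · rwa [negNonconst_of_const hf, negNonconst_of_const (hiff.1 hf)]
  · rw [negNonconst_of_not_const hf, negNonconst_of_not_const (mt hiff.2 hf)]
    exact h.mono fun a ha => congrArg Neg.neg ha

theorem negNonconst_negNonconst (f : α → ℤ) : negNonconst u (negNonconst u f) = f := by
  by_cases hf : ∃ c, ∀ᶠ a in u, f a = c
  · rw [negNonconst_of_const hf, negNonconst_of_const hf]
  · have hf' : ¬ ∃ c, ∀ᶠ a in u, (-f) a = c := fun ⟨c, hc⟩ =>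
      hf ⟨-c, hc.mono fun a ha => by simp only [Pi.neg_apply] at ha; lia⟩
    rw [negNonconst_of_not_const hf, negNonconst_of_not_const hf', neg_neg]

theorem eventually_abs_sub_negNonconst (h : ∀ᶠ a in u, |f a - g a| = d) :
    ∀ᶠ a in u, |negNonconst u f a - negNonconst u g a| = d := by
  have hiff : (∃ c, ∀ᶠ a in u, f a = c) ↔ ∃ c, ∀ᶠ a in u, g a = c :=
    ⟨eventually_const_of_abs_sub_eq h,
      eventually_const_of_abs_sub_eq (h.mono fun a ha => by rwa [abs_sub_comm])⟩
  by_cases hf : ∃ c, ∀ᶠ a in u, f a = c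
  · rwa [negNonconst_of_const hf, negNonconst_of_const (hiff.1 hf)]
  · rw [negNonconst_of_not_const hf, negNonconst_of_not_const (mt hiff.2 hf)]
    refine h.mono fun a ha => ?_
    rwa [Pi.neg_apply, Pi.neg_apply, neg_sub_neg, abs_sub_comm]

end NegNonconst

theorem not_definableBy_CZ_BZ {n : ℕ} (hn : 1 ≤ n) : ¬ DefinableBy (CZ n) (BZ n) := by
  intro h
  let u := Filter.hyperfilter ℕ
  have hid (d : ℤ) : ¬ ∃ c : ℤ, ∀ᶠ a : ℕ in u, (a : ℤ) + d = c := by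
    rintro ⟨c, hc⟩
    refine Set.Finite.notMem_hyperfilter (Set.Subsingleton.finite ?_) hc
    intro a (ha : (a : ℤ) + d = c) b (hb : (b : ℤ) + d = c)
    lia
  have hconst (d : ℤ) : negNonconst u (fun _ => d) = fun _ => d :=
    negNonconst_of_const ⟨d, .of_forall fun _ => rfl⟩
  have hnonconst (d : ℤ) :
      negNonconst u (fun a => (a : ℤ) + d) = -fun a : ℕ => (a : ℤ) + d :=
    negNonconst_of_not_const (hid d)
  have key := h.eventually_involution_iff u (negNonconst u)
    (fun _ _ => negNonconst_congr)
    (fun f => .of_forall fun a => congrFun (negNonconst_negNonconst f) a)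
    (fun v => ⟨fun hv => by
        simpa only [CZ, negNonconst_negNonconst] using eventually_abs_sub_negNonconst hv,
      fun hv => eventually_abs_sub_negNonconst hv⟩)
    ![fun _ => (n : ℤ), fun _ => 0, fun a => (a : ℤ) + n, fun a => (a : ℤ) + 0]
  obtain ⟨a, ha⟩ := (key.2 (.of_forall fun a => by simp [BZ])).exists
  simp only [BZ, Matrix.cons_val, hconst, hnonconst, Pi.neg_apply] at ha
  lia

/-- For `n ≥ 1` : `A_n ≻ B_n ≻ C_n`, i.e. `A_n ≽ B_n` but not `B_n ≽ A_n`, and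
`B_n ≽ C_n` but not `C_n ≽ B_n`. -/
theorem A_B_C_strict (n : ℕ) (hn : 1 ≤ n) :
    (DefinableBy (AZ n) (BZ n) ∧ ¬ DefinableBy (BZ n) (AZ n)) ∧
    (DefinableBy (BZ n) (CZ n) ∧ ¬ DefinableBy (CZ n) (BZ n)) :=
  ⟨⟨definableBy_AZ_BZ n, not_definableBy_BZ_AZ hn⟩,
    definableBy_BZ_CZ n, not_definableBy_CZ_BZ hn⟩
end
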